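/- arXiv:2405.17930 — 2 statements merged into one kernel-verified Lean document; each statement's English description precedes it below -/
import Mathlib

section
/- Let K be an algebraically closed field of characteristic zero and A = K⟨v1,v2,v3⟩ the free associative K-algebra. Let α̃1, α̃2, α̃3, β̃1, β̃2, β̃3 ∈ {0,1} ⊆ K satisfy α̃1α̃2 + α̃2α̃3 − α̃1α̃3 − α̃2 = 0 and β̃1β̃2 + β̃2β̃3 − β̃1β̃3 − β̃2 = 0, and let ⟪-,-⟫ : A⊗A → A⊗A be a K-linear map satisfying the Leibniz rules with ⟪v_i,v_i⟫ = 0 for i = 1,2,3, ⟪v1,v2⟫ = α̃3·(v1⊗v2) − β̃3·(v2⊗v1), ⟪v2,v1⟫ = (−1+β̃3)·(v1⊗v2) + (1−α̃3)·(v2⊗v1), ⟪v1,v3⟫ = α̃2·(v1⊗v3) − β̃2·(v3⊗v1), ⟪v3,v1⟫ = (−1+β̃2)·(v1⊗v3) + (1−α̃2)·(v3⊗v1), ⟪v2,v3⟫ = α̃1·(v2⊗v3) − β̃1·(v3⊗v2), ⟪v3,v2⟫ = (−1+β̃1)·(v2⊗v3) + (1−α̃1)·(v3⊗v2). Then: (1)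 for all u, v, w in the K-linear span V = Kv1 ⊕ Kv2 ⊕ Kv3 of the generators, ⟪u,v⟫ + ⟪v,u⟫° = u⊗v − v⊗u and DJac(u,v,w) = −(v ⊗₁ ⟪u,w⟫) (i.e., the restriction of ⟪-,-⟫ to V⊗V is a 1-double Lie algebra structure on V); and (2) ⟪-,-⟫ is a modified double Poisson bracket on A. -/
open TensorProduct

noncomputable section

variable (K : Type*) [Field K]
variable (A : Type*) [Ring A] [Algebra K A]

/-- Leibniz rules for a double-bracket-type operation. -/
def LeibnizRules (D : A ⊗[K] A →ₗ[K] A ⊗[K] A) : Prop :=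
  (∀ a b c : A,
      D (a ⊗ₜ[K] (b * c)) =
        (b ⊗ₜ[K] (1 : A)) * D (a ⊗ₜ[K] c) + D (a ⊗ₜ[K] b) * ((1 : A) ⊗ₜ[K] c))
  ∧ (∀ a b c : A,
      D ((a * b) ⊗ₜ[K] c) =
        ((1 : A) ⊗ₜ[K] a) * D (b ⊗ₜ[K] c) + D (a ⊗ₜ[K] c) * (b ⊗ₜ[K] (1 : A)))

/-- The associated bracket `{a,b} = m(⟪a,b⟫)`. -/
def br (D : A ⊗[K] A →ₗ[K] A ⊗[K] A) (a b : A) : A :=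
  LinearMap.mul' K A (D (a ⊗ₜ[K] b))

/-- The K-span of commutators `[A,A]`. -/
def commutatorSpan : Submodule K A :=
  Submodule.span K {x : A | ∃ a b : A, x = a * b - b * a}

/-- The flip on `A ⊗ A`. -/
def flipT : A ⊗[K] A →ₗ[K] A ⊗[K] A := (TensorProduct.comm K A A).toLinearMap

/-- Swap of the last two tensor factors of `(A ⊗ A) ⊗ A`. -/
def swap23 : ((A ⊗[K] A) ⊗[K] A) →ₗ[K] ((A ⊗[K] A) ⊗[K] A) :=
  (TensorProduct.assoc K A A A).symm.toLinearMap ∘ₗ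
    (LinearMap.lTensor A (TensorProduct.comm K A A).toLinearMap) ∘ₗ
    (TensorProduct.assoc K A A A).toLinearMap

/-- `⟪a, -⟫_L` on double tensors: `b ⊗ c ↦ ⟪a,b⟫ ⊗ c`. -/
def dL (D : A ⊗[K] A →ₗ[K] A ⊗[K] A) (a : A) :
    A ⊗[K] A →ₗ[K] (A ⊗[K] A) ⊗[K] A :=
  LinearMap.rTensor A (D ∘ₗ TensorProduct.mk K A A a)

/-- `⟪a, -⟫_R` on double tensors: `b ⊗ c ↦ b ⊗ ⟪a,c⟫`. -/
def dR (D : A ⊗[K] A →ₗ[K] A ⊗[K] A) (a : A) :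
    A ⊗[K] A →ₗ[K] (A ⊗[K] A) ⊗[K] A :=
  (TensorProduct.assoc K A A A).symm.toLinearMap ∘ₗ
    LinearMap.lTensor A (D ∘ₗ TensorProduct.mk K A A a)

/-- `⟪-, c⟫_L` on double tensors: `b ⊗ b' ↦ ⟪b,c⟫' ⊗ b' ⊗ ⟪b,c⟫''`. -/
def dLfst (D : A ⊗[K] A →ₗ[K] A ⊗[K] A) (c : A) :
    A ⊗[K] A →ₗ[K] (A ⊗[K] A) ⊗[K] A :=
  swap23 K A ∘ₗ LinearMap.rTensor A (D ∘ₗ (TensorProduct.mk K A A).flip c)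

/-- The double Jacobiator. -/
def DJac (D : A ⊗[K] A →ₗ[K] A ⊗[K] A) (a b c : A) : (A ⊗[K] A) ⊗[K] A :=
  dL K A D a (D (b ⊗ₜ[K] c)) - dR K A D b (D (a ⊗ₜ[K] c)) - dLfst K A D c (D (a ⊗ₜ[K] b))

/-- `c ⊗₁ (-)` : `w' ⊗ w'' ↦ w' ⊗ c ⊗ w''`. -/
def otimes1 (c : A) : A ⊗[K] A →ₗ[K] (A ⊗[K] A) ⊗[K] A :=
  LinearMap.rTensor A ((TensorProduct.mk K A A).flip c)

variable {ι : Type*}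

/-- Mixed double algebra structure of weight `lam` with respect to the generators `v`. -/
def IsMixedDouble (v : ι → A) (lam : ι → K) (D : A ⊗[K] A →ₗ[K] A ⊗[K] A) : Prop :=
  LeibnizRules K A D ∧
  ∀ i j : ι,
    D (v i ⊗ₜ[K] v j) + flipT K A (D (v j ⊗ₜ[K] v i)) =
      ((lam i + lam j) / 2) • (v i ⊗ₜ[K] v j - v j ⊗ₜ[K] v i) +
      ((lam i - lam j) / 2) • ((1 : A) ⊗ₜ[K] (v i * v j) - (v j * v i) ⊗ₜ[K] (1 : A))

/-- Mixed double Poisson algebra structure of weight `lam` w.r.t. the generators `v`. -/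
def IsMixedDoublePoisson (v : ι → A) (lam : ι → K) (D : A ⊗[K] A →ₗ[K] A ⊗[K] A) : Prop :=
  IsMixedDouble K A v lam D ∧
  ∀ i j k : ι,
    DJac K A D (v i) (v j) (v k) =
      (-((lam i + lam j) / 2)) • otimes1 K A (v j) (D (v i ⊗ₜ[K] v k)) +
      ((lam i - lam j) / 2) •
        otimes1 K A (1 : A) (((1 : A) ⊗ₜ[K] v j) * D (v i ⊗ₜ[K] v k))

/-- Modified double Poisson bracket. -/
def IsModifiedDoublePoisson (D : A ⊗[K] A →ₗ[K] A ⊗[K] A) : Prop :=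
  LeibnizRules K A D ∧
  (∀ a b : A, br K A D a b + br K A D b a ∈ commutatorSpan K A) ∧
  (∀ a b c : A,
    br K A D a (br K A D b c) - br K A D b (br K A D a c) - br K A D (br K A D a b) c = 0)

end


section Helpers

variable {K : Type*} [Field K] {A : Type*} [Ring A] [Algebra K A]
variable (D : A ⊗[K] A →ₗ[K] A ⊗[K] A)

/-- `x ⊗ y ↦ x p y`. -/
noncomputable def insM (p : A) : A ⊗[K] A →ₗ[K] A :=
  TensorProduct.lift ((LinearMap.mul K A) ∘ₗ (LinearMap.mulRight K p))

/-- `x ⊗ y ⊗ z ↦ x p y z`. -/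
noncomputable def insM3 (p : A) : (A ⊗[K] A) ⊗[K] A →ₗ[K] A :=
  TensorProduct.lift ((LinearMap.mul K A) ∘ₗ (insM (K := K) p))

/-- `p ⊗ q ↦ ⟪p,c⟫' q ⟪p,c⟫''`. -/
noncomputable def phiM (c : A) : A ⊗[K] A →ₗ[K] A :=
  insM3 (1 : A) ∘ₗ dLfst K A D c

@[simp] lemma insM_tmul (p x y : A) : insM (K := K) p (x ⊗ₜ[K] y) = x * p * y := rfl

@[simp] lemma insM3_tmul (p x y z : A) :
    insM3 (K := K) p ((x ⊗ₜ[K] y) ⊗ₜ[K] z) = x * p * y * z := rfl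

@[simp] lemma flipT_tmul (x y : A) : flipT K A (x ⊗ₜ[K] y) = y ⊗ₜ[K] x := rfl

@[simp] lemma swap23_tmul (x y z : A) :
    swap23 K A ((x ⊗ₜ[K] y) ⊗ₜ[K] z) = (x ⊗ₜ[K] z) ⊗ₜ[K] y := rfl

@[simp] lemma dL_tmul (a x y : A) : dL K A D a (x ⊗ₜ[K] y) = D (a ⊗ₜ[K] x) ⊗ₜ[K] y := rfl

@[simp] lemma dR_tmul (a x y : A) :
    dR K A D a (x ⊗ₜ[K] y) = (TensorProduct.assoc K A A A).symm (x ⊗ₜ[K] D (a ⊗ₜ[K] y)) := rfl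

@[simp] lemma dLfst_tmul (c x y : A) :
    dLfst K A D c (x ⊗ₜ[K] y) = swap23 K A (D (x ⊗ₜ[K] c) ⊗ₜ[K] y) := rfl

@[simp] lemma otimes1_tmul (c x y : A) :
    otimes1 K A c (x ⊗ₜ[K] y) = (x ⊗ₜ[K] c) ⊗ₜ[K] y := rfl

/-- `s ↦ 1 ⊗ s' ⊗ s''`. -/
noncomputable def j23 : A ⊗[K] A →ₗ[K] (A ⊗[K] A) ⊗[K] A :=
  (TensorProduct.assoc K A A A).symm.toLinearMap ∘ₗ TensorProduct.mk K A (A ⊗[K] A) 1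

@[simp] lemma j23_tmul (x y : A) :
    j23 (x ⊗ₜ[K] y) = ((1 : A) ⊗ₜ[K] x) ⊗ₜ[K] y := rfl

variable {D}

lemma D_one_right (hL : LeibnizRules K A D) (a : A) : D (a ⊗ₜ[K] 1) = 0 := by
  have h := hL.1 a 1 1
  rw [mul_one, ← Algebra.TensorProduct.one_def, one_mul, mul_one] at h
  simpa using h

lemma D_one_left (hL : LeibnizRules K A D) (a : A) : D (1 ⊗ₜ[K] a) = 0 := by
  have h := hL.2 1 1 a
  rw [mul_one, ← Algebra.TensorProduct.one_def, one_mul, mul_one] at h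
  simpa using h

lemma D_alg_right (hL : LeibnizRules K A D) (a : A) (r : K) :
    D (a ⊗ₜ[K] algebraMap K A r) = 0 := by
  rw [Algebra.algebraMap_eq_smul_one, TensorProduct.tmul_smul, map_smul, D_one_right hL, smul_zero]

lemma D_alg_left (hL : LeibnizRules K A D) (a : A) (r : K) :
    D (algebraMap K A r ⊗ₜ[K] a) = 0 := by
  rw [Algebra.algebraMap_eq_smul_one, ← TensorProduct.smul_tmul', map_smul, D_one_left hL, smul_zero]

/-! Auxiliary expansion rules. -/

lemma dL_mul1 (hL : LeibnizRules K A D) (a c : A) (w : A ⊗[K] A) :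
    dL K A D a ((c ⊗ₜ[K] 1) * w) = ((c ⊗ₜ[K] 1) ⊗ₜ[K] 1) * dL K A D a w
      + (D (a ⊗ₜ[K] c) ⊗ₜ[K] 1) * j23 w := by
  induction w with
  | zero => simp
  | add x y hx hy => simp only [mul_add, map_add, hx, hy]; abel
  | tmul x y => simp [hL.1, TensorProduct.add_tmul]

lemma dL_mul2 (a d : A) (w : A ⊗[K] A) :
    dL K A D a (w * (1 ⊗ₜ[K] d)) = dL K A D a w * ((1 ⊗ₜ[K] 1) ⊗ₜ[K] d) := by
  induction w with
  | zero => simp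
  | add x y hx hy => simp only [add_mul, map_add, hx, hy]
  | tmul x y => simp [← Algebra.TensorProduct.one_def]

lemma dL_mul3 (a d : A) (w : A ⊗[K] A) :
    dL K A D a ((1 ⊗ₜ[K] d) * w) = ((1 ⊗ₜ[K] 1) ⊗ₜ[K] d) * dL K A D a w := by
  induction w with
  | zero => simp
  | add x y hx hy => simp only [mul_add, map_add, hx, hy]
  | tmul x y => simp [← Algebra.TensorProduct.one_def]

lemma dL_mul4 (hL : LeibnizRules K A D) (a d : A) (w : A ⊗[K] A) :
    dL K A D a (w * (d ⊗ₜ[K] 1)) = dL K A D a w * ((1 ⊗ₜ[K] d) ⊗ₜ[K] 1)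
      + otimes1 K A 1 w * (D (a ⊗ₜ[K] d) ⊗ₜ[K] 1) := by
  induction w with
  | zero => simp
  | add x y hx hy => simp only [add_mul, map_add, hx, hy]; abel
  | tmul x y => simp [hL.1, TensorProduct.add_tmul, add_comm]

lemma assoc_mulx (c x : A) (s t : A ⊗[K] A) :
    (TensorProduct.assoc K A A A).symm ((c * x) ⊗ₜ[K] (s * t))
      = (TensorProduct.assoc K A A A).symm (c ⊗ₜ[K] s)
        * (TensorProduct.assoc K A A A).symm (x ⊗ₜ[K] t) := by
  induction s with
  | zero => simp
  | add p q hp hq => simp only [add_mul, TensorProduct.tmul_add, map_add, hp, hq]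
  | tmul p q =>
    induction t with
    | zero => simp
    | add p q hp hq => simp only [mul_add, TensorProduct.tmul_add, map_add, hp, hq]
    | tmul p q => simp

lemma dR_mul1 (b c : A) (w : A ⊗[K] A) :
    dR K A D b ((c ⊗ₜ[K] 1) * w) = ((c ⊗ₜ[K] 1) ⊗ₜ[K] 1) * dR K A D b w := by
  induction w with
  | zero => simp
  | add x y hx hy => simp only [mul_add, map_add, hx, hy]
  | tmul x y =>
    have := assoc_mulx c x (1 ⊗ₜ[K] 1) (D (b ⊗ₜ[K] y))
    rw [← Algebra.TensorProduct.one_def, one_mul] at this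
    simp [this, Algebra.TensorProduct.one_def]

lemma dR_mul2 (hL : LeibnizRules K A D) (b d : A) (w : A ⊗[K] A) :
    dR K A D b (w * (1 ⊗ₜ[K] d)) = dR K A D b w * ((1 ⊗ₜ[K] 1) ⊗ₜ[K] d)
      + (w ⊗ₜ[K] 1) * j23 (D (b ⊗ₜ[K] d)) := by
  induction w with
  | zero => simp
  | add x y hx hy =>
    simp only [add_mul, map_add, hx, hy, TensorProduct.add_tmul]; abel
  | tmul x y =>
    have h1 := assoc_mulx x 1 (D (b ⊗ₜ[K] y)) (1 ⊗ₜ[K] d)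
    have h2 := assoc_mulx x 1 (y ⊗ₜ[K] 1) (D (b ⊗ₜ[K] d))
    rw [mul_one] at h1 h2
    simp [hL.1, TensorProduct.tmul_add, h1, h2, j23, add_comm]

lemma dR_mul3 (hL : LeibnizRules K A D) (b a : A) (w : A ⊗[K] A) :
    dR K A D b ((1 ⊗ₜ[K] a) * w) = ((1 ⊗ₜ[K] a) ⊗ₜ[K] 1) * dR K A D b w
      + j23 (D (b ⊗ₜ[K] a)) * otimes1 K A 1 w := by
  induction w with
  | zero => simp
  | add x y hx hy =>
    simp only [mul_add, map_add, hx, hy]; abel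
  | tmul x y =>
    have h1 := assoc_mulx 1 x (a ⊗ₜ[K] 1) (D (b ⊗ₜ[K] y))
    have h2 := assoc_mulx 1 x (D (b ⊗ₜ[K] a)) (1 ⊗ₜ[K] y)
    rw [one_mul] at h1 h2
    simp [hL.1, TensorProduct.tmul_add, h1, h2, j23]

lemma dR_mul4 (b a : A) (w : A ⊗[K] A) :
    dR K A D b (w * (a ⊗ₜ[K] 1)) = dR K A D b w * ((a ⊗ₜ[K] 1) ⊗ₜ[K] 1) := by
  induction w with
  | zero => simp
  | add x y hx hy => simp only [add_mul, map_add, hx, hy]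
  | tmul x y =>
    have := assoc_mulx x a (D (b ⊗ₜ[K] y)) (1 ⊗ₜ[K] 1)
    rw [← Algebra.TensorProduct.one_def, mul_one] at this
    simp [this, Algebra.TensorProduct.one_def]

/-- `⟪bb', -⟫_R`. -/
lemma dR_prod (hL : LeibnizRules K A D) (b b' : A) (w : A ⊗[K] A) :
    dR K A D (b * b') w = ((1 ⊗ₜ[K] 1) ⊗ₜ[K] b) * dR K A D b' w
      + dR K A D b w * ((1 ⊗ₜ[K] b') ⊗ₜ[K] 1) := by
  induction w with
  | zero => simp
  | add x y hx hy => simp only [add_mul, mul_add, map_add, hx, hy]; abel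
  | tmul x y =>
    have h1 := assoc_mulx 1 x (1 ⊗ₜ[K] b) (D (b' ⊗ₜ[K] y))
    have h2 := assoc_mulx x 1 (D (b ⊗ₜ[K] y)) (b' ⊗ₜ[K] 1)
    rw [one_mul] at h1
    rw [mul_one] at h2
    simp [hL.2, TensorProduct.tmul_add, h1, h2]

/-- `⟪aa', -⟫_L`. -/
lemma dL_prod (hL : LeibnizRules K A D) (a a' : A) (w : A ⊗[K] A) :
    dL K A D (a * a') w = ((1 ⊗ₜ[K] a) ⊗ₜ[K] 1) * dL K A D a' w
      + dL K A D a w * ((a' ⊗ₜ[K] 1) ⊗ₜ[K] 1) := by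
  induction w with
  | zero => simp
  | add x y hx hy => simp only [add_mul, mul_add, map_add, hx, hy]; abel
  | tmul x y => simp [hL.2, TensorProduct.add_tmul]

lemma swap23_mul (x y : (A ⊗[K] A) ⊗[K] A) :
    swap23 K A (x * y) = swap23 K A x * swap23 K A y := by
  induction x with
  | zero => simp
  | add p q hp hq => simp only [add_mul, map_add, hp, hq]
  | tmul x z =>
    induction x with
    | zero => simp
    | add p q hp hq => simp only [add_mul, TensorProduct.add_tmul, map_add, hp, hq]
    | tmul x1 x2 =>
      induction y with
      | zero => simp
      | add p q hp hq => simp only [mul_add, map_add, hp, hq]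
      | tmul y w =>
        induction y with
        | zero => simp
        | add p q hp hq => simp only [mul_add, TensorProduct.add_tmul, map_add, hp, hq]
        | tmul y1 y2 => simp

lemma dLfst_c (hL : LeibnizRules K A D) (c d : A) (w : A ⊗[K] A) :
    dLfst K A D (c * d) w = ((c ⊗ₜ[K] 1) ⊗ₜ[K] 1) * dLfst K A D d w
      + dLfst K A D c w * ((1 ⊗ₜ[K] 1) ⊗ₜ[K] d) := by
  induction w with
  | zero => simp
  | add x y hx hy => simp only [add_mul, mul_add, map_add, hx, hy]; abel
  | tmul x y =>
    have h1 := swap23_mul ((c ⊗ₜ[K] (1 : A)) ⊗ₜ[K] (1 : A)) (D (x ⊗ₜ[K] d) ⊗ₜ[K] y)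
    have h2 := swap23_mul (D (x ⊗ₜ[K] c) ⊗ₜ[K] y) (((1 : A) ⊗ₜ[K] d) ⊗ₜ[K] (1 : A))
    simp at h1 h2
    simp [hL.1, TensorProduct.add_tmul, h1, h2]

lemma dLfst_mul1 (hL : LeibnizRules K A D) (c b : A) (w : A ⊗[K] A) :
    dLfst K A D c ((b ⊗ₜ[K] 1) * w) = ((1 ⊗ₜ[K] 1) ⊗ₜ[K] b) * dLfst K A D c w
      + otimes1 K A 1 (D (b ⊗ₜ[K] c)) * (w ⊗ₜ[K] 1) := by
  induction w with
  | zero => simp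
  | add x y hx hy => simp only [mul_add, map_add, hx, hy, TensorProduct.add_tmul]; abel
  | tmul x y =>
    have h1 := swap23_mul (((1 : A) ⊗ₜ[K] b) ⊗ₜ[K] (1 : A)) (D (x ⊗ₜ[K] c) ⊗ₜ[K] y)
    have h2 : ∀ t : A ⊗[K] A, swap23 K A ((t * (x ⊗ₜ[K] (1 : A))) ⊗ₜ[K] y)
        = otimes1 K A 1 t * ((x ⊗ₜ[K] y) ⊗ₜ[K] 1) := by
      intro t
      induction t with
      | zero => simp
      | add p q hp hq => simp only [add_mul, map_add, hp, hq, TensorProduct.add_tmul]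
      | tmul p q => simp
    simp at h1
    simp [hL.2, TensorProduct.add_tmul, h1, h2]

lemma dLfst_mul2 (c b : A) (w : A ⊗[K] A) :
    dLfst K A D c (w * (1 ⊗ₜ[K] b)) = dLfst K A D c w * ((1 ⊗ₜ[K] b) ⊗ₜ[K] 1) := by
  induction w with
  | zero => simp
  | add x y hx hy => simp only [add_mul, map_add, hx, hy]
  | tmul x y =>
    have h1 := swap23_mul (D (x ⊗ₜ[K] c) ⊗ₜ[K] y) (((1 : A) ⊗ₜ[K] (1 : A)) ⊗ₜ[K] b)
    simp [← Algebra.TensorProduct.one_def] at h1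
    simp [h1, Algebra.TensorProduct.one_def]

lemma dLfst_mul3 (c b : A) (w : A ⊗[K] A) :
    dLfst K A D c ((1 ⊗ₜ[K] b) * w) = ((1 ⊗ₜ[K] b) ⊗ₜ[K] 1) * dLfst K A D c w := by
  induction w with
  | zero => simp
  | add x y hx hy => simp only [mul_add, map_add, hx, hy]
  | tmul x y =>
    have h1 := swap23_mul (((1 : A) ⊗ₜ[K] (1 : A)) ⊗ₜ[K] b) (D (x ⊗ₜ[K] c) ⊗ₜ[K] y)
    simp [← Algebra.TensorProduct.one_def] at h1
    simp [h1, Algebra.TensorProduct.one_def]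

lemma dLfst_mul4 (hL : LeibnizRules K A D) (c a : A) (w : A ⊗[K] A) :
    dLfst K A D c (w * (a ⊗ₜ[K] 1)) = dLfst K A D c w * ((a ⊗ₜ[K] 1) ⊗ₜ[K] 1)
      + j23 (flipT K A w) * otimes1 K A 1 (D (a ⊗ₜ[K] c)) := by
  induction w with
  | zero => simp
  | add x y hx hy => simp only [add_mul, map_add, hx, hy]; abel
  | tmul x y =>
    have h1 := swap23_mul (D (x ⊗ₜ[K] c) ⊗ₜ[K] y) ((a ⊗ₜ[K] (1 : A)) ⊗ₜ[K] (1 : A))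
    have h2 : ∀ t : A ⊗[K] A, swap23 K A ((((1 : A) ⊗ₜ[K] x) * t) ⊗ₜ[K] y)
        = ((1 ⊗ₜ[K] y) ⊗ₜ[K] x) * otimes1 K A 1 t := by
      intro t
      induction t with
      | zero => simp
      | add p q hp hq => simp only [mul_add, map_add, hp, hq, TensorProduct.add_tmul]
      | tmul p q => simp
    simp at h1
    simp [hL.2, TensorProduct.add_tmul, h1, h2, add_comm]

/-! Leibniz rules for the double Jacobiator. -/

lemma DJac_c (hL : LeibnizRules K A D) (a b c d : A) :
    DJac K A D a b (c * d) = ((c ⊗ₜ[K] 1) ⊗ₜ[K] 1) * DJac K A D a b d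
      + DJac K A D a b c * ((1 ⊗ₜ[K] 1) ⊗ₜ[K] d) := by
  unfold DJac
  rw [hL.1, hL.1, dLfst_c hL]
  simp only [map_add, dL_mul1 hL, dL_mul2, dR_mul1, dR_mul2 hL, mul_sub, sub_mul]
  abel

lemma DJac_b (hL : LeibnizRules K A D) (a b b' c : A) :
    DJac K A D a (b * b') c = ((1 ⊗ₜ[K] 1) ⊗ₜ[K] b) * DJac K A D a b' c
      + DJac K A D a b c * ((1 ⊗ₜ[K] b') ⊗ₜ[K] 1) := by
  unfold DJac
  rw [hL.1, hL.2, dR_prod hL]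
  simp only [map_add, dL_mul3, dL_mul4 hL, dLfst_mul1 hL, dLfst_mul2, mul_sub, sub_mul]
  abel

/-- Skew-symmetry defect. -/
noncomputable def defS (D : A ⊗[K] A →ₗ[K] A ⊗[K] A) (a b : A) : A ⊗[K] A :=
  D (a ⊗ₜ[K] b) + flipT K A (D (b ⊗ₜ[K] a))

lemma DJac_a (hL : LeibnizRules K A D) (a a' b c : A) :
    DJac K A D (a * a') b c = ((1 ⊗ₜ[K] a) ⊗ₜ[K] 1) * DJac K A D a' b c
      + DJac K A D a b c * ((a' ⊗ₜ[K] 1) ⊗ₜ[K] 1)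
      - j23 (defS D b a) * otimes1 K A 1 (D (a' ⊗ₜ[K] c)) := by
  unfold DJac defS
  rw [hL.2, hL.2, dL_prod hL]
  simp only [map_add, dR_mul3 hL, dR_mul4, dLfst_mul3, dLfst_mul4 hL, mul_sub, sub_mul, add_mul]
  abel

lemma flip_mul (x y : A ⊗[K] A) : flipT K A (x * y) = flipT K A x * flipT K A y := by
  induction x with
  | zero => simp
  | add p q hp hq => simp only [add_mul, map_add, hp, hq]
  | tmul p q =>
    induction y with
    | zero => simp
    | add p q hp hq => simp only [mul_add, map_add, hp, hq]
    | tmul p q => simp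

lemma defS_right (hL : LeibnizRules K A D) (a b c : A) :
    defS D a (b * c) = (b ⊗ₜ[K] 1) * defS D a c + defS D a b * (1 ⊗ₜ[K] c) := by
  unfold defS
  rw [hL.1, hL.2]
  simp only [map_add, flip_mul, flipT_tmul, mul_add, add_mul]
  abel

lemma defS_left (hL : LeibnizRules K A D) (a b c : A) :
    defS D (a * b) c = (1 ⊗ₜ[K] a) * defS D b c + defS D a c * (b ⊗ₜ[K] 1) := by
  unfold defS
  rw [hL.1, hL.2]
  simp only [map_add, flip_mul, flipT_tmul, mul_add, add_mul]
  abel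

lemma mulp_flip (x : A ⊗[K] A) :
    LinearMap.mul' K A x - LinearMap.mul' K A (flipT K A x) ∈ commutatorSpan K A := by
  induction x with
  | zero => simp
  | add p q hp hq =>
    simp only [map_add]
    rw [add_sub_add_comm]
    exact Submodule.add_mem _ hp hq
  | tmul p q =>
    simp only [flipT_tmul, LinearMap.mul'_apply]
    exact Submodule.subset_span ⟨p, q, rfl⟩

end Helpers
/-- Induction principle and twisted derivation on an algebra generated by `v`. -/
structure FreeLike (K : Type*) [Field K] (A : Type*) [Ring A] [Algebra K A] (X : Type*) where
  v : X → A
  Del : A → A ⊗[K] A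
  ind : ∀ {motive : A → Prop} (grade0 : ∀ r : K, motive (algebraMap K A r))
    (grade1 : ∀ x : X, motive (v x))
    (mul : ∀ a b : A, motive a → motive b → motive (a * b))
    (add : ∀ a b : A, motive a → motive b → motive (a + b)) (a : A), motive a
  Del_mul : ∀ a b : A, Del (a * b) = (1 ⊗ₜ[K] a) * Del b + Del a * (b ⊗ₜ[K] 1)
  Del_add : ∀ a b : A, Del (a + b) = Del a + Del b
  Del_alg : ∀ r : K, Del (algebraMap K A r) = 0
  Del_gen : ∀ x : X, Del (v x) = v x ⊗ₜ[K] 1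

section Abstract

variable {K : Type*} [Field K] {A : Type*} [Ring A] [Algebra K A] {X : Type*}
variable (F : FreeLike K A X)

/-- The companion twisted derivation. -/
noncomputable def Del' (a : A) : A ⊗[K] A :=
  F.Del a - a ⊗ₜ[K] 1 + 1 ⊗ₜ[K] a

lemma Del'_mul (a b : A) :
    Del' F (a * b) = (1 ⊗ₜ[K] a) * Del' F b + Del' F a * (b ⊗ₜ[K] 1) := by
  simp [Del', F.Del_mul, mul_add, add_mul, mul_sub, sub_mul]
  abel

lemma Del'_add (a b : A) : Del' F (a + b) = Del' F a + Del' F b := by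
  simp [Del', F.Del_add, TensorProduct.tmul_add, TensorProduct.add_tmul]
  abel

lemma Del'_alg (r : K) : Del' F (algebraMap K A r) = 0 := by
  rw [Del', F.Del_alg]
  simp [Algebra.algebraMap_eq_smul_one, TensorProduct.smul_tmul']

lemma Del'_gen (x : X) : Del' F (F.v x) = 1 ⊗ₜ[K] F.v x := by
  simp [Del', F.Del_gen]

/-- Sum of cyclic rotations. -/
noncomputable def Ncyc (a : A) : A :=
  LinearMap.mul' K A (F.Del a)

lemma Ncyc' (a : A) :
    LinearMap.mul' K A (Del' F a) = Ncyc F a := by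
  simp [Ncyc, Del']

variable {D : A ⊗[K] A →ₗ[K] A ⊗[K] A}

lemma defS_add_right (a b c : A) : defS D a (b + c) = defS D a b + defS D a c := by
  simp only [defS, TensorProduct.tmul_add, TensorProduct.add_tmul, map_add]; abel

lemma defS_add_left (a b c : A) : defS D (a + b) c = defS D a c + defS D b c := by
  simp only [defS, TensorProduct.tmul_add, TensorProduct.add_tmul, map_add]; abel

lemma defS_gen (hL : LeibnizRules K A D)
    (hS : ∀ i j : X, defS D (F.v i) (F.v j) =
      F.v i ⊗ₜ[K] F.v j - F.v j ⊗ₜ[K] F.v i)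
    (b : A) (j : X) :
    defS D b (F.v j) =
      F.Del b * (1 ⊗ₜ[K] F.v j) - (F.v j ⊗ₜ[K] 1) * Del' F b := by
  induction b using F.ind with
  | grade0 r => simp [defS, D_alg_left hL, D_alg_right hL, F.Del_alg, Del'_alg]
  | grade1 x => simp [hS, F.Del_gen, Del'_gen]
  | mul a b ha hb =>
    have hc : ∀ u v : A, (u ⊗ₜ[K] (1 : A)) * (1 ⊗ₜ[K] v)
      = (1 ⊗ₜ[K] v) * (u ⊗ₜ[K] 1) := by intro u v; simp
    rw [defS_left hL, ha, hb, F.Del_mul, Del'_mul]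
    simp only [mul_sub, sub_mul, mul_add, add_mul, mul_assoc, hc]
    simp only [← mul_assoc, hc]
    abel
  | add a b ha hb =>
    rw [defS_add_left, ha, hb, F.Del_add, Del'_add]
    simp only [mul_add, add_mul]; abel

/-- `p ⊗ q ↦ pb ⊗ q - p ⊗ bq`. -/
noncomputable def Hmap (b : A) :
    A ⊗[K] A →ₗ[K] A ⊗[K] A :=
  LinearMap.rTensor _ (LinearMap.mulRight K b) - LinearMap.lTensor _ (LinearMap.mulLeft K b)

@[simp] lemma Hmap_tmul (b p q : A) :
    Hmap b (p ⊗ₜ[K] q) = (p * b) ⊗ₜ[K] q - p ⊗ₜ[K] (b * q) := by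
  simp [Hmap]

lemma Hmap_left (a b : A) (w : A ⊗[K] A) :
    Hmap b ((a ⊗ₜ[K] 1) * w) = (a ⊗ₜ[K] 1) * Hmap b w := by
  induction w with
  | zero => simp
  | add x y hx hy => simp only [mul_add, map_add, hx, hy]
  | tmul x y => simp [mul_sub, mul_assoc]

lemma Hmap_right (a b : A) (w : A ⊗[K] A) :
    Hmap b (w * (1 ⊗ₜ[K] a)) = Hmap b w * (1 ⊗ₜ[K] a) := by
  induction w with
  | zero => simp
  | add x y hx hy => simp only [add_mul, map_add, hx, hy]
  | tmul x y => simp [sub_mul, mul_assoc]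

lemma mul_Hmap (b : A) (w : A ⊗[K] A) :
    LinearMap.mul' K A (Hmap b w) = 0 := by
  induction w with
  | zero => simp
  | add x y hx hy => simp only [map_add, hx, hy, add_zero]
  | tmul x y => simp [mul_assoc]

lemma mul_left' (a : A) (w : A ⊗[K] A) :
    LinearMap.mul' K A ((a ⊗ₜ[K] 1) * w)
      = a * LinearMap.mul' K A w := by
  induction w with
  | zero => simp
  | add x y hx hy => simp only [mul_add, map_add, hx, hy]
  | tmul x y => simp [mul_assoc]

lemma mul_right' (a : A) (w : A ⊗[K] A) :
    LinearMap.mul' K A (w * (1 ⊗ₜ[K] a))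
      = LinearMap.mul' K A w * a := by
  induction w with
  | zero => simp
  | add x y hx hy => simp only [add_mul, map_add, hx, hy]
  | tmul x y => simp [mul_assoc]

lemma defS_eq (hL : LeibnizRules K A D)
    (hS : ∀ i j : X, defS D (F.v i) (F.v j) =
      F.v i ⊗ₜ[K] F.v j - F.v j ⊗ₜ[K] F.v i)
    (b a : A) :
    defS D b a = F.Del b * (1 ⊗ₜ[K] a) - (a ⊗ₜ[K] 1) * F.Del b
      + Hmap b (flipT K A (Del' F a)) := by
  induction a using F.ind with
  | grade0 r =>
    simp only [defS, D_alg_left hL, D_alg_right hL, Del'_alg, map_zero]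
    simp [Algebra.algebraMap_eq_smul_one, ← TensorProduct.smul_tmul',
      ← Algebra.TensorProduct.one_def]
  | grade1 x =>
    rw [defS_gen F hL hS, Del'_gen, Del']
    simp [mul_add, mul_sub]
    abel
  | mul x y hx hy =>
    rw [defS_right hL, hx, hy, Del'_mul, map_add, flip_mul, flip_mul]
    simp only [flipT_tmul, map_add, Hmap_left, Hmap_right]
    have e1 : (x * y) ⊗ₜ[K] (1 : A) = (x ⊗ₜ[K] 1) * (y ⊗ₜ[K] 1) := by simp
    have e2 : (1 : A) ⊗ₜ[K] (x * y) = (1 ⊗ₜ[K] x) * (1 ⊗ₜ[K] y) := by simp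
    rw [e1, e2]
    noncomm_ring
  | add x y hx hy =>
    rw [defS_add_right, hx, hy, Del'_add]
    simp only [TensorProduct.tmul_add, TensorProduct.add_tmul, map_add, mul_add, add_mul]
    abel

lemma mul_defS (hL : LeibnizRules K A D)
    (hS : ∀ i j : X, defS D (F.v i) (F.v j) =
      F.v i ⊗ₜ[K] F.v j - F.v j ⊗ₜ[K] F.v i)
    (b a : A) :
    LinearMap.mul' K A (defS D b a) = Ncyc F b * a - a * Ncyc F b := by
  rw [defS_eq F hL hS, map_add, mul_Hmap, map_sub, mul_left', mul_right', add_zero]; rfl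

/-! The functional `phiM`. -/

lemma insM3_swap (t : A ⊗[K] A) (q : A) :
    insM3 1 (swap23 K A (t ⊗ₜ[K] q)) = insM q t := by
  induction t with
  | zero => simp
  | add x y hx hy => simp only [TensorProduct.add_tmul, map_add, hx, hy]
  | tmul x y => simp

lemma phiM_tmul (c p q : A) :
    phiM D c (p ⊗ₜ[K] q) = insM q (D (p ⊗ₜ[K] c)) := by
  simp [phiM, insM3_swap]

lemma insM_mul1 (p a : A) (t : A ⊗[K] A) :
    insM p ((1 ⊗ₜ[K] a) * t) = insM (p * a) t := by
  induction t with
  | zero => simp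
  | add x y hx hy => simp only [mul_add, map_add, hx, hy]
  | tmul x y => simp [mul_assoc]

lemma insM_mul2 (p a : A) (t : A ⊗[K] A) :
    insM p (t * (a ⊗ₜ[K] 1)) = insM (a * p) t := by
  induction t with
  | zero => simp
  | add x y hx hy => simp only [add_mul, map_add, hx, hy]
  | tmul x y => simp [mul_assoc]

lemma insM_add (p q : A) (t : A ⊗[K] A) :
    insM (p + q) t = insM p t + insM q t := by
  induction t with
  | zero => simp
  | add x y hx hy => simp only [map_add, hx, hy]; abel
  | tmul x y => simp [mul_add, add_mul]

lemma insM_sub (p q : A) (t : A ⊗[K] A) :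
    insM (p - q) t = insM p t - insM q t := by
  induction t with
  | zero => simp
  | add x y hx hy => simp only [map_add, hx, hy]; abel
  | tmul x y => simp [mul_sub, sub_mul]

lemma phiM_prod (hL : LeibnizRules K A D) (c p p' q : A) :
    phiM D c ((p * p') ⊗ₜ[K] q) = phiM D c (p' ⊗ₜ[K] (q * p)) + phiM D c (p ⊗ₜ[K] (p' * q)) := by
  simp only [phiM_tmul, hL.2, map_add, insM_mul1, insM_mul2]

lemma phiM_left (hL : LeibnizRules K A D) (c a : A)
    (s : A ⊗[K] A) :
    phiM D c ((a ⊗ₜ[K] 1) * s) = phiM D c (s * (1 ⊗ₜ[K] a))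
      + phiM D c (a ⊗ₜ[K] LinearMap.mul' K A s) := by
  induction s with
  | zero => simp
  | add x y hx hy => simp only [mul_add, add_mul, map_add, TensorProduct.tmul_add, hx, hy]; abel
  | tmul x y => simp [phiM_prod hL]

lemma phiM_H (hL : LeibnizRules K A D) (c b : A)
    (s : A ⊗[K] A) :
    phiM D c (Hmap b (flipT K A s))
      = phiM D c (b ⊗ₜ[K] LinearMap.mul' K A s) := by
  induction s with
  | zero => simp
  | add x y hx hy => simp only [map_add, TensorProduct.tmul_add, hx, hy]
  | tmul x y => simp [phiM_prod hL]

lemma phiM_defS (hL : LeibnizRules K A D)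
    (hS : ∀ i j : X, defS D (F.v i) (F.v j) =
      F.v i ⊗ₜ[K] F.v j - F.v j ⊗ₜ[K] F.v i)
    (c b a : A) :
    phiM D c (defS D b a) = phiM D c (b ⊗ₜ[K] Ncyc F a) - phiM D c (a ⊗ₜ[K] Ncyc F b) := by
  rw [defS_eq F hL hS, map_add, map_sub, phiM_left hL, phiM_H hL, Ncyc']
  change _ - (_ + phiM D c (a ⊗ₜ[K] Ncyc F b)) + _ = _
  abel

/-! Double Jacobiator on the free algebra. -/

lemma j23_left (b : A) (s : A ⊗[K] A) :
    j23 ((1 ⊗ₜ[K] b) * s) = ((1 ⊗ₜ[K] 1) ⊗ₜ[K] b) * j23 s := by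
  induction s with
  | zero => simp
  | add x y hx hy => simp only [mul_add, map_add, hx, hy]
  | tmul x y => simp

lemma j23_right (b : A) (s : A ⊗[K] A) :
    j23 (s * (b ⊗ₜ[K] 1)) = j23 s * ((1 ⊗ₜ[K] b) ⊗ₜ[K] 1) := by
  induction s with
  | zero => simp
  | add x y hx hy => simp only [add_mul, map_add, hx, hy]
  | tmul x y => simp

lemma otimes1_comm (b : A) (s : A ⊗[K] A) :
    otimes1 K A 1 s * ((1 ⊗ₜ[K] b) ⊗ₜ[K] 1)
      = ((1 ⊗ₜ[K] b) ⊗ₜ[K] 1) * otimes1 K A 1 s := by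
  induction s with
  | zero => simp
  | add x y hx hy => simp only [add_mul, mul_add, map_add, hx, hy]
  | tmul x y => simp

lemma otimes1_eq (b : A) (s : A ⊗[K] A) :
    j23 (b ⊗ₜ[K] 1) * otimes1 K A 1 s = otimes1 K A b s := by
  induction s with
  | zero => simp
  | add x y hx hy => simp only [mul_add, map_add, hx, hy]
  | tmul x y => simp

lemma otimes1_left (b c : A) (s : A ⊗[K] A) :
    otimes1 K A b ((c ⊗ₜ[K] 1) * s)
      = ((c ⊗ₜ[K] 1) ⊗ₜ[K] 1) * otimes1 K A b s := by
  induction s with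
  | zero => simp
  | add x y hx hy => simp only [mul_add, map_add, hx, hy]
  | tmul x y => simp

lemma otimes1_right (b c : A) (s : A ⊗[K] A) :
    otimes1 K A b (s * (1 ⊗ₜ[K] c))
      = otimes1 K A b s * ((1 ⊗ₜ[K] 1) ⊗ₜ[K] c) := by
  induction s with
  | zero => simp
  | add x y hx hy => simp only [add_mul, map_add, hx, hy]
  | tmul x y => simp

lemma dL_add (a b : A) (s : A ⊗[K] A) :
    dL K A D (a + b) s
      = dL K A D a s + dL K A D b s := by
  induction s with
  | zero => simp
  | add x y hx hy => simp only [map_add, hx, hy]; abel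
  | tmul x y => simp [TensorProduct.add_tmul]

lemma dR_add (a b : A) (s : A ⊗[K] A) :
    dR K A D (a + b) s
      = dR K A D a s + dR K A D b s := by
  induction s with
  | zero => simp
  | add x y hx hy => simp only [map_add, hx, hy]; abel
  | tmul x y => simp [TensorProduct.add_tmul, TensorProduct.tmul_add]

lemma dLfst_add (a b : A) (s : A ⊗[K] A) :
    dLfst K A D (a + b) s
      = dLfst K A D a s + dLfst K A D b s := by
  induction s with
  | zero => simp
  | add x y hx hy => simp only [map_add, hx, hy]; abel
  | tmul x y => simp [TensorProduct.add_tmul, TensorProduct.tmul_add]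

lemma otimes1_add (a b : A) (s : A ⊗[K] A) :
    otimes1 K A (a + b) s
      = otimes1 K A a s + otimes1 K A b s := by
  induction s with
  | zero => simp
  | add x y hx hy => simp only [map_add, hx, hy]; abel
  | tmul x y => simp [TensorProduct.add_tmul, TensorProduct.tmul_add]

lemma dL_smul (r : K) (b : A) (s : A ⊗[K] A) :
    dL K A D (r • b) s = r • dL K A D b s := by
  induction s with
  | zero => simp
  | add x y hx hy => simp only [map_add, hx, hy, smul_add]
  | tmul x y => simp [← TensorProduct.smul_tmul']

lemma dR_smul (r : K) (b : A) (s : A ⊗[K] A) :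
    dR K A D (r • b) s = r • dR K A D b s := by
  induction s with
  | zero => simp
  | add x y hx hy => simp only [map_add, hx, hy, smul_add]
  | tmul x y => simp [← TensorProduct.smul_tmul']

lemma dLfst_smul (r : K) (b : A) (s : A ⊗[K] A) :
    dLfst K A D (r • b) s = r • dLfst K A D b s := by
  induction s with
  | zero => simp
  | add x y hx hy => simp only [map_add, hx, hy, smul_add]
  | tmul x y => simp [← TensorProduct.smul_tmul']

lemma otimes1_smul (r : K) (b : A) (s : A ⊗[K] A) :
    otimes1 K A (r • b) s = r • otimes1 K A b s := by
  induction s with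
  | zero => simp
  | add x y hx hy => simp only [map_add, hx, hy, smul_add]
  | tmul x y => simp [← TensorProduct.smul_tmul']

lemma DJac_add_a (a a' b c : A) : DJac K A D (a + a') b c
    = DJac K A D a b c + DJac K A D a' b c := by
  simp only [DJac, dL_add, TensorProduct.add_tmul, TensorProduct.tmul_add, map_add]; abel

lemma DJac_add_b (a b b' c : A) : DJac K A D a (b + b') c
    = DJac K A D a b c + DJac K A D a b' c := by
  simp only [DJac, dR_add, TensorProduct.add_tmul, TensorProduct.tmul_add, map_add]; abel

lemma DJac_add_c (a b c c' : A) : DJac K A D a b (c + c')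
    = DJac K A D a b c + DJac K A D a b c' := by
  simp only [DJac, dLfst_add, TensorProduct.add_tmul, TensorProduct.tmul_add, map_add]; abel

lemma DJac_smul_a (r : K) (a b c : A) : DJac K A D (r • a) b c
    = r • DJac K A D a b c := by
  simp only [DJac, dL_smul, ← TensorProduct.smul_tmul', TensorProduct.tmul_smul, map_smul, smul_sub]

lemma DJac_smul_b (r : K) (a b c : A) : DJac K A D a (r • b) c
    = r • DJac K A D a b c := by
  simp only [DJac, dR_smul, ← TensorProduct.smul_tmul', TensorProduct.tmul_smul, map_smul, smul_sub]

lemma DJac_smul_c (r : K) (a b c : A) : DJac K A D a b (r • c)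
    = r • DJac K A D a b c := by
  simp only [DJac, dLfst_smul, ← TensorProduct.smul_tmul', TensorProduct.tmul_smul, map_smul,
    smul_sub]

lemma dL_one (hL : LeibnizRules K A D)
    (s : A ⊗[K] A) : dL K A D 1 s = 0 := by
  induction s with
  | zero => simp
  | add x y hx hy => simp only [map_add, hx, hy, add_zero]
  | tmul x y => simp [D_one_left hL]

lemma dR_one (hL : LeibnizRules K A D)
    (s : A ⊗[K] A) : dR K A D 1 s = 0 := by
  induction s with
  | zero => simp
  | add x y hx hy => simp only [map_add, hx, hy, add_zero]
  | tmul x y => simp [D_one_left hL]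

lemma dLfst_one (hL : LeibnizRules K A D)
    (s : A ⊗[K] A) : dLfst K A D 1 s = 0 := by
  induction s with
  | zero => simp
  | add x y hx hy => simp only [map_add, hx, hy, add_zero]
  | tmul x y => simp [D_one_right hL]

lemma DJac_alg_a (hL : LeibnizRules K A D) (r : K) (b c : A) :
    DJac K A D (algebraMap K _ r) b c = 0 := by
  rw [Algebra.algebraMap_eq_smul_one, DJac_smul_a]
  simp [DJac, D_one_left hL, dL_one hL]

lemma DJac_alg_b (hL : LeibnizRules K A D) (r : K) (a c : A) :
    DJac K A D a (algebraMap K _ r) c = 0 := by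
  rw [Algebra.algebraMap_eq_smul_one, DJac_smul_b]
  simp [DJac, D_one_left hL, D_one_right hL, dR_one hL]

lemma DJac_alg_c (hL : LeibnizRules K A D) (r : K) (a b : A) :
    DJac K A D a b (algebraMap K _ r) = 0 := by
  rw [Algebra.algebraMap_eq_smul_one, DJac_smul_c]
  simp [DJac, D_one_right hL, dLfst_one hL]

lemma t_neg_mul (x y : (A ⊗[K] A) ⊗[K] A) : (-x) * y = -(x * y) :=
  eq_neg_of_add_eq_zero_left (by rw [← add_mul, neg_add_cancel, zero_mul])

lemma t_mul_neg (x y : (A ⊗[K] A) ⊗[K] A) : x * (-y) = -(x * y) :=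
  eq_neg_of_add_eq_zero_left (by rw [← mul_add, neg_add_cancel, mul_zero])

lemma DJac_gen2 (hL : LeibnizRules K A D)
    (hJ : ∀ i j k : X, DJac K A D (F.v i) (F.v j)
      (F.v k) = -(otimes1 K A (F.v j)
        (D (F.v i ⊗ₜ[K] F.v k))))
    (i j : X) (c : A) :
    DJac K A D (F.v i) (F.v j) c
      = -(otimes1 K A (F.v j) (D (F.v i ⊗ₜ[K] c))) := by
  induction c using F.ind with
  | grade0 r => simp [DJac_alg_c hL, D_alg_right hL]
  | grade1 x => exact hJ i j x
  | mul x y hx hy =>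
    rw [DJac_c hL, hx, hy, hL.1, map_add, otimes1_left, otimes1_right]
    rw [t_neg_mul, t_mul_neg, neg_add]
  | add x y hx hy =>
    rw [DJac_add_c, hx, hy, TensorProduct.tmul_add, map_add, map_add, neg_add]

lemma DJac_gen1 (hL : LeibnizRules K A D)
    (hJ : ∀ i j k : X, DJac K A D (F.v i) (F.v j)
      (F.v k) = -(otimes1 K A (F.v j)
        (D (F.v i ⊗ₜ[K] F.v k))))
    (i : X) (b c : A) :
    DJac K A D (F.v i) b c
      = -(j23 (F.Del b) * otimes1 K A 1 (D (F.v i ⊗ₜ[K] c))) := by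
  induction b using F.ind with
  | grade0 r => simp [DJac_alg_b hL, F.Del_alg]
  | grade1 x => rw [DJac_gen2 F hL hJ, F.Del_gen, otimes1_eq]
  | mul x y hx hy =>
    rw [DJac_b hL, hx, hy, F.Del_mul, map_add, j23_left, j23_right, add_mul, t_neg_mul, t_mul_neg,
      mul_assoc, mul_assoc, mul_assoc, otimes1_comm, neg_add]
  | add x y hx hy =>
    rw [DJac_add_b, hx, hy, F.Del_add, map_add, add_mul, neg_add]

lemma insM3_a1 (p a : A) (t : (A ⊗[K] A) ⊗[K] A) :
    insM3 p (((1 ⊗ₜ[K] a) ⊗ₜ[K] 1) * t) = insM3 (p * a) t := by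
  induction t with
  | zero => simp
  | add x y hx hy => simp only [mul_add, map_add, hx, hy]
  | tmul x z =>
    induction x with
    | zero => simp
    | add x y hx hy => simp only [TensorProduct.add_tmul, mul_add, map_add, hx, hy]
    | tmul x y => simp [mul_assoc]

lemma insM3_a2 (p a : A) (t : (A ⊗[K] A) ⊗[K] A) :
    insM3 p (t * ((a ⊗ₜ[K] 1) ⊗ₜ[K] 1)) = insM3 (a * p) t := by
  induction t with
  | zero => simp
  | add x y hx hy => simp only [add_mul, map_add, hx, hy]
  | tmul x z =>
    induction x with
    | zero => simp
    | add x y hx hy => simp only [TensorProduct.add_tmul, add_mul, map_add, hx, hy]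
    | tmul x y => simp [mul_assoc]

lemma insM3_j (p : A) (s t : A ⊗[K] A) :
    insM3 p (j23 s * otimes1 K A 1 t)
      = insM (p * LinearMap.mul' K A s) t := by
  induction s with
  | zero => simp [insM_sub (K := K) p p t, show insM (K := K) (0 : A) t = 0 from by
      have := insM_sub (K := K) p p t; simpa using this]
  | add x y hx hy => simp only [add_mul, mul_add, map_add, hx, hy, insM_add]
  | tmul x z =>
    induction t with
    | zero => simp
    | add x y hx hy => simp only [mul_add, map_add, hx, hy]
    | tmul x y => simp [mul_assoc]

lemma insM3_DJac (hL : LeibnizRules K A D)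
    (hS : ∀ i j : X, defS D (F.v i) (F.v j) =
      F.v i ⊗ₜ[K] F.v j - F.v j ⊗ₜ[K] F.v i)
    (hJ : ∀ i j k : X, DJac K A D (F.v i) (F.v j)
      (F.v k) = -(otimes1 K A (F.v j)
        (D (F.v i ⊗ₜ[K] F.v k))))
    (a b c p : A) :
    insM3 p (DJac K A D a b c) = - insM (p * Ncyc F b) (D (a ⊗ₜ[K] c)) := by
  induction a using F.ind generalizing p with
  | grade0 r => simp [DJac_alg_a hL, D_alg_left hL]
  | grade1 x => rw [DJac_gen1 F hL hJ, map_neg, insM3_j]; rfl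
  | mul x y hx hy =>
    rw [DJac_a hL, map_sub, map_add, insM3_a1, insM3_a2, hx, hy, insM3_j, mul_defS F hL hS, hL.2,
      map_add, insM_mul1, insM_mul2, mul_sub, insM_sub]
    simp only [mul_assoc]
    abel
  | add x y hx hy =>
    rw [DJac_add_a, map_add, hx, hy, TensorProduct.add_tmul, map_add, map_add, neg_add]

lemma insM3_dL (a : A) (s : A ⊗[K] A)
    (hL : LeibnizRules K A D) :
    insM3 1 (dL K A D a s) + insM3 1 (dR K A D a s)
      = br K A D a (LinearMap.mul' K A s) := by
  have h1 : ∀ (t : A ⊗[K] A) (y : A),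
      insM3 1 (t ⊗ₜ[K] y) = LinearMap.mul' K A t * y := by
    intro t y
    induction t with
    | zero => simp
    | add x y hx hy => simp only [TensorProduct.add_tmul, map_add, add_mul, hx, hy]
    | tmul x y => simp
  have h2 : ∀ (t : A ⊗[K] A) (y : A),
      insM3 1 ((TensorProduct.assoc K _ _ _).symm (y ⊗ₜ[K] t))
        = y * LinearMap.mul' K A t := by
    intro t y
    induction t with
    | zero => simp
    | add x y hx hy => simp only [TensorProduct.tmul_add, map_add, mul_add, hx, hy]
    | tmul x y => simp [mul_assoc]
  induction s with
  | zero => simp [br]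
  | add x y hx hy =>
    simp only [br] at hx hy ⊢
    simp only [map_add, TensorProduct.tmul_add, ← hx, ← hy]; abel
  | tmul x y =>
    simp only [dL_tmul, dR_tmul, h1, h2, br, LinearMap.mul'_apply, hL.1, map_add, mul_left',
      mul_right']
    abel

lemma phiM_flip (c : A) (s : A ⊗[K] A)
    (hL : LeibnizRules K A D) :
    phiM D c s + phiM D c (flipT K A s)
      = br K A D (LinearMap.mul' K A s) c := by
  have h0 : ∀ t : A ⊗[K] A,
      LinearMap.mul' K A t = insM 1 t := by
    intro t
    induction t with
    | zero => simp
    | add x y hx hy => simp only [map_add, hx, hy]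
    | tmul x y => simp
  induction s with
  | zero => simp [br]
  | add x y hx hy =>
    simp only [br] at hx hy ⊢
    simp only [map_add, TensorProduct.add_tmul, ← hx, ← hy]; abel
  | tmul x y =>
    simp only [flipT_tmul, phiM_tmul, br, LinearMap.mul'_apply, hL.2]
    rw [h0, map_add, insM_mul1, insM_mul2, one_mul, mul_one, add_comm]

theorem isMDP (hL : LeibnizRules K A D)
    (hS : ∀ i j : X, defS D (F.v i) (F.v j) =
      F.v i ⊗ₜ[K] F.v j - F.v j ⊗ₜ[K] F.v i)
    (hJ : ∀ i j k : X, DJac K A D (F.v i) (F.v j)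
      (F.v k) = -(otimes1 K A (F.v j)
        (D (F.v i ⊗ₜ[K] F.v k)))) :
    IsModifiedDoublePoisson K A D := by
  refine ⟨hL, fun a b => ?_, fun a b c => ?_⟩
  · have h1 := mul_defS F hL hS a b
    rw [defS, map_add] at h1
    have h2 := mulp_flip (D (b ⊗ₜ[K] a))
    have h3 : Ncyc F a * b - b * Ncyc F a ∈ commutatorSpan K A :=
      Submodule.subset_span ⟨_, _, rfl⟩
    rw [← h1] at h3
    have h4 := Submodule.add_mem _ h3 h2
    have e : br K A D a b + br K A D b a
        = LinearMap.mul' K A (D (a ⊗ₜ[K] b))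
          + LinearMap.mul' K A (flipT K A (D (b ⊗ₜ[K] a)))
          + (LinearMap.mul' K A (D (b ⊗ₜ[K] a))
            - LinearMap.mul' K A (flipT K A (D (b ⊗ₜ[K] a)))) := by
      simp only [br]; abel
    rw [e]; exact h4
  · have j1 := insM3_DJac F hL hS hJ a b c 1
    have j2 := insM3_DJac F hL hS hJ b a c 1
    rw [one_mul, ← phiM_tmul] at j1 j2
    have s1 := phiM_defS F hL hS c b a
    rw [defS, map_add] at s1
    have p1 := phiM_flip c (D (a ⊗ₜ[K] b)) hL
    have q1 := insM3_dL a (D (b ⊗ₜ[K] c)) hL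
    have q2 := insM3_dL b (D (a ⊗ₜ[K] c)) hL
    unfold DJac at j1 j2
    rw [map_sub, map_sub] at j1 j2
    change _ - _ - phiM D c (D (a ⊗ₜ[K] b)) = _ at j1
    change _ - _ - phiM D c (D (b ⊗ₜ[K] a)) = _ at j2
    change br K _ D a (LinearMap.mul' K _ (D (b ⊗ₜ[K] c)))
      - br K _ D b (LinearMap.mul' K _ (D (a ⊗ₜ[K] c)))
      - br K _ D (LinearMap.mul' K _ (D (a ⊗ₜ[K] b))) c = 0
    rw [← q1, ← q2, ← p1]
    linear_combination (norm := abel) j1 - j2 - s1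

end Abstract

section Free

variable {K : Type*} [Field K] {X : Type*}

/-- Matrix model of the twisted derivation `b ↦ Σ b_{≥j} ⊗ b_{<j}`. -/
noncomputable def DelHom : FreeAlgebra K X →ₐ[K]
    Matrix (Fin 2) (Fin 2) (FreeAlgebra K X ⊗[K] FreeAlgebra K X) :=
  FreeAlgebra.lift K (fun x =>
    !![(1 : FreeAlgebra K X) ⊗ₜ[K] FreeAlgebra.ι K x, FreeAlgebra.ι K x ⊗ₜ[K] (1 : FreeAlgebra K X);
       0, FreeAlgebra.ι K x ⊗ₜ[K] (1 : FreeAlgebra K X)])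

lemma DelHom_diag (a : FreeAlgebra K X) :
    DelHom a 0 0 = 1 ⊗ₜ[K] a ∧ DelHom a 1 0 = 0 ∧ DelHom a 1 1 = a ⊗ₜ[K] 1 := by
  induction a using FreeAlgebra.induction with
  | grade0 r =>
    simp [Matrix.algebraMap_matrix_apply, Algebra.algebraMap_eq_smul_one, TensorProduct.smul_tmul',
      Algebra.TensorProduct.one_def]
  | grade1 x => simp [DelHom]
  | mul a b ha hb =>
    obtain ⟨h1, h2, h3⟩ := ha
    obtain ⟨g1, g2, g3⟩ := hb
    simp [map_mul, Matrix.mul_apply, Fin.sum_univ_two, h1, h2, h3, g1, g2, g3]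
  | add a b ha hb =>
    obtain ⟨h1, h2, h3⟩ := ha
    obtain ⟨g1, g2, g3⟩ := hb
    simp [h1, h2, h3, g1, g2, g3, TensorProduct.tmul_add, TensorProduct.add_tmul]

/-- The twisted derivation. -/
noncomputable def Del (a : FreeAlgebra K X) : FreeAlgebra K X ⊗[K] FreeAlgebra K X := DelHom a 0 1

lemma Del_mul (a b : FreeAlgebra K X) :
    Del (a * b) = (1 ⊗ₜ[K] a) * Del b + Del a * (b ⊗ₜ[K] 1) := by
  simp [Del, map_mul, Matrix.mul_apply, Fin.sum_univ_two, DelHom_diag]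

lemma Del_add (a b : FreeAlgebra K X) : Del (a + b) = Del a + Del b := by simp [Del]

lemma Del_alg (r : K) : Del (algebraMap K (FreeAlgebra K X) r) = 0 := by
  simp [Del, Matrix.algebraMap_matrix_apply]

lemma Del_gen (x : X) : Del (FreeAlgebra.ι K x) = FreeAlgebra.ι K x ⊗ₜ[K] 1 := by
  simp [Del, DelHom]


/-- The free algebra as an instance. -/
noncomputable def freeF (K : Type*) [Field K] (X : Type*) : FreeLike K (FreeAlgebra K X) X where
  v := FreeAlgebra.ι K
  Del := Del
  ind := fun h0 h1 hm ha a => FreeAlgebra.induction K X h0 h1 hm ha a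
  Del_mul := Del_mul
  Del_add := Del_add
  Del_alg := Del_alg
  Del_gen := Del_gen

end Free

section Gens

variable {K : Type*} [Field K] {A : Type*} [Ring A] [Algebra K A]

lemma hS_gens (a1 a2 a3 b1 b2 b3 : K) (v : Fin 3 → A)
    (D : A ⊗[K] A →ₗ[K] A ⊗[K] A)
    (h11 : D (v 0 ⊗ₜ[K] v 0) = 0) (h22 : D (v 1 ⊗ₜ[K] v 1) = 0) (h33 : D (v 2 ⊗ₜ[K] v 2) = 0)
    (h12 : D (v 0 ⊗ₜ[K] v 1) = a3 • (v 0 ⊗ₜ[K] v 1) - b3 • (v 1 ⊗ₜ[K] v 0))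
    (h21 : D (v 1 ⊗ₜ[K] v 0) = (-1 + b3) • (v 0 ⊗ₜ[K] v 1) + (1 - a3) • (v 1 ⊗ₜ[K] v 0))
    (h13 : D (v 0 ⊗ₜ[K] v 2) = a2 • (v 0 ⊗ₜ[K] v 2) - b2 • (v 2 ⊗ₜ[K] v 0))
    (h31 : D (v 2 ⊗ₜ[K] v 0) = (-1 + b2) • (v 0 ⊗ₜ[K] v 2) + (1 - a2) • (v 2 ⊗ₜ[K] v 0))
    (h23 : D (v 1 ⊗ₜ[K] v 2) = a1 • (v 1 ⊗ₜ[K] v 2) - b1 • (v 2 ⊗ₜ[K] v 1))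
    (h32 : D (v 2 ⊗ₜ[K] v 1) = (-1 + b1) • (v 1 ⊗ₜ[K] v 2) + (1 - a1) • (v 2 ⊗ₜ[K] v 1))
    (i j : Fin 3) : defS D (v i) (v j) = v i ⊗ₜ[K] v j - v j ⊗ₜ[K] v i := by
  fin_cases i <;> fin_cases j <;>
    simp only [Fin.zero_eta, Fin.mk_one, Fin.reduceFinMk, defS, h11, h22, h33, h12, h21, h13, h31,
      h23, h32, map_add, map_sub, map_smul, flipT_tmul, map_zero] <;> module

set_option maxHeartbeats 4000000 in
lemma hJ_gens (a1 a2 a3 b1 b2 b3 : K) (v : Fin 3 → A)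
    (ha1 : a1 * a1 = a1) (ha2 : a2 * a2 = a2) (ha3 : a3 * a3 = a3)
    (hb1 : b1 * b1 = b1) (hb2 : b2 * b2 = b2) (hb3 : b3 * b3 = b3)
    (hacond : a1 * a2 + a2 * a3 - a1 * a3 - a2 = 0)
    (hbcond : b1 * b2 + b2 * b3 - b1 * b3 - b2 = 0)
    (D : A ⊗[K] A →ₗ[K] A ⊗[K] A)
    (h11 : D (v 0 ⊗ₜ[K] v 0) = 0) (h22 : D (v 1 ⊗ₜ[K] v 1) = 0) (h33 : D (v 2 ⊗ₜ[K] v 2) = 0)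
    (h12 : D (v 0 ⊗ₜ[K] v 1) = a3 • (v 0 ⊗ₜ[K] v 1) - b3 • (v 1 ⊗ₜ[K] v 0))
    (h21 : D (v 1 ⊗ₜ[K] v 0) = (-1 + b3) • (v 0 ⊗ₜ[K] v 1) + (1 - a3) • (v 1 ⊗ₜ[K] v 0))
    (h13 : D (v 0 ⊗ₜ[K] v 2) = a2 • (v 0 ⊗ₜ[K] v 2) - b2 • (v 2 ⊗ₜ[K] v 0))
    (h31 : D (v 2 ⊗ₜ[K] v 0) = (-1 + b2) • (v 0 ⊗ₜ[K] v 2) + (1 - a2) • (v 2 ⊗ₜ[K] v 0))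
    (h23 : D (v 1 ⊗ₜ[K] v 2) = a1 • (v 1 ⊗ₜ[K] v 2) - b1 • (v 2 ⊗ₜ[K] v 1))
    (h32 : D (v 2 ⊗ₜ[K] v 1) = (-1 + b1) • (v 1 ⊗ₜ[K] v 2) + (1 - a1) • (v 2 ⊗ₜ[K] v 1))
    (i j k : Fin 3) :
    DJac K A D (v i) (v j) (v k) = -(otimes1 K A (v j) (D (v i ⊗ₜ[K] v k))) := by
  fin_cases i <;> fin_cases j <;> fin_cases k <;>
    simp only [Fin.zero_eta, Fin.mk_one, Fin.reduceFinMk, DJac, h11, h22, h33, h12, h21, h13, h31,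
      h23, h32, map_add, map_sub, map_smul, flipT_tmul, map_zero, dL_tmul, dR_tmul, dLfst_tmul,
      otimes1_tmul, TensorProduct.add_tmul, TensorProduct.tmul_add, TensorProduct.sub_tmul,
      TensorProduct.tmul_sub, ← TensorProduct.smul_tmul', TensorProduct.tmul_smul,
      TensorProduct.zero_tmul, TensorProduct.tmul_zero,
      swap23_tmul, TensorProduct.assoc_symm_tmul, smul_zero, sub_zero, neg_zero] <;>
    (try match_scalars) <;> grind

lemma part1 (v : Fin 3 → A) (D : A ⊗[K] A →ₗ[K] A ⊗[K] A)
    (hS : ∀ i j, defS D (v i) (v j) = v i ⊗ₜ[K] v j - v j ⊗ₜ[K] v i)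
    (hJ : ∀ i j k, DJac K A D (v i) (v j) (v k) = -(otimes1 K A (v j) (D (v i ⊗ₜ[K] v k))))
    (x y z : A) (hx : x ∈ Submodule.span K ({v 0, v 1, v 2} : Set A))
    (hy : y ∈ Submodule.span K ({v 0, v 1, v 2} : Set A))
    (hz : z ∈ Submodule.span K ({v 0, v 1, v 2} : Set A)) :
    D (x ⊗ₜ[K] y) + flipT K A (D (y ⊗ₜ[K] x)) = x ⊗ₜ[K] y - y ⊗ₜ[K] x ∧
      DJac K A D x y z = -(otimes1 K A y (D (x ⊗ₜ[K] z))) := by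
  have hset : ({v 0, v 1, v 2} : Set A) = Set.range v := by
    ext t
    simp only [Set.mem_insert_iff, Set.mem_singleton_iff, Set.mem_range, Fin.exists_fin_succ]
    simp [eq_comm]
  rw [hset] at hx hy hz
  constructor
  · change defS D x y = _
    have h1 : ∀ i, defS D (v i) y = v i ⊗ₜ[K] y - y ⊗ₜ[K] v i := by
      intro i
      induction hy using Submodule.span_induction with
      | mem t ht => obtain ⟨j, rfl⟩ := ht; exact hS i j
      | zero => simp [defS]
      | add p q _ _ hp hq =>
        rw [defS_add_right, hp, hq, TensorProduct.add_tmul, TensorProduct.tmul_add]; abel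
      | smul r p _ hp =>
        have : defS D (v i) (r • p) = r • defS D (v i) p := by
          simp only [defS, TensorProduct.tmul_smul, ← TensorProduct.smul_tmul', map_smul, smul_add]
        rw [this, hp, TensorProduct.tmul_smul, ← TensorProduct.smul_tmul', smul_sub]
    induction hx using Submodule.span_induction with
    | mem t ht => obtain ⟨j, rfl⟩ := ht; exact h1 j
    | zero => simp [defS]
    | add p q _ _ hp hq =>
      rw [defS_add_left, hp, hq, TensorProduct.add_tmul, TensorProduct.tmul_add]; abel
    | smul r p _ hp =>
      have : defS D (r • p) y = r • defS D p y := by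
        simp only [defS, TensorProduct.tmul_smul, ← TensorProduct.smul_tmul', map_smul, smul_add]
      rw [this, hp, TensorProduct.tmul_smul, ← TensorProduct.smul_tmul', smul_sub]
  · have h1 : ∀ i j, DJac K A D (v i) (v j) z = -(otimes1 K A (v j) (D (v i ⊗ₜ[K] z))) := by
      intro i j
      induction hz using Submodule.span_induction with
      | mem t ht => obtain ⟨k, rfl⟩ := ht; exact hJ i j k
      | zero =>
        have := DJac_smul_c (D := D) 0 (v i) (v j) 0
        rw [zero_smul, zero_smul] at this
        simp [this]
      | add p q _ _ hp hq =>
        rw [DJac_add_c, hp, hq, TensorProduct.tmul_add, map_add, map_add, neg_add]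
      | smul r p _ hp =>
        rw [DJac_smul_c, hp, TensorProduct.tmul_smul, map_smul, map_smul, smul_neg]
    have h2 : ∀ i, DJac K A D (v i) y z = -(otimes1 K A y (D (v i ⊗ₜ[K] z))) := by
      intro i
      induction hy using Submodule.span_induction with
      | mem t ht => obtain ⟨k, rfl⟩ := ht; exact h1 i k
      | zero =>
        have := DJac_smul_b (D := D) 0 (v i) 0 z
        have e := otimes1_smul (0 : K) (0 : A) (D (v i ⊗ₜ[K] z))
        rw [zero_smul, zero_smul] at this e
        rw [this, e, neg_zero]
      | add p q _ _ hp hq => rw [DJac_add_b, hp, hq, otimes1_add, neg_add]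
      | smul r p _ hp => rw [DJac_smul_b, hp, otimes1_smul, smul_neg]
    induction hx using Submodule.span_induction with
    | mem t ht => obtain ⟨k, rfl⟩ := ht; exact h2 k
    | zero =>
      have := DJac_smul_a (D := D) 0 0 y z
      rw [zero_smul, zero_smul] at this
      simp [this]
    | add p q _ _ hp hq =>
      rw [DJac_add_a, hp, hq, TensorProduct.add_tmul, map_add, map_add, neg_add]
    | smul r p _ hp =>
      rw [DJac_smul_a, hp, ← TensorProduct.smul_tmul', map_smul, map_smul, smul_neg]

end Gens

theorem stmt16 {K : Type*} [Field K] [IsAlgClosed K] [CharZero K]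
    (a1 a2 a3 b1 b2 b3 : K)
    (ha1 : a1 = 0 ∨ a1 = 1)
    (ha2 : a2 = 0 ∨ a2 = 1)
    (ha3 : a3 = 0 ∨ a3 = 1)
    (hb1 : b1 = 0 ∨ b1 = 1)
    (hb2 : b2 = 0 ∨ b2 = 1)
    (hb3 : b3 = 0 ∨ b3 = 1)
    (hacond : a1 * a2 + a2 * a3 - a1 * a3 - a2 = 0)
    (hbcond : b1 * b2 + b2 * b3 - b1 * b3 - b2 = 0)
    (D : FreeAlgebra K (Fin 3) ⊗[K] FreeAlgebra K (Fin 3) →ₗ[K] FreeAlgebra K (Fin 3) ⊗[K] FreeAlgebra K (Fin 3))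
    (hL : LeibnizRules K (FreeAlgebra K (Fin 3)) D)
    (h11 : D (FreeAlgebra.ι K (0 : Fin 3) ⊗ₜ[K] FreeAlgebra.ι K (0 : Fin 3)) = 0)
    (h22 : D (FreeAlgebra.ι K (1 : Fin 3) ⊗ₜ[K] FreeAlgebra.ι K (1 : Fin 3)) = 0)
    (h33 : D (FreeAlgebra.ι K (2 : Fin 3) ⊗ₜ[K] FreeAlgebra.ι K (2 : Fin 3)) = 0)
    (h12 : D (FreeAlgebra.ι K (0 : Fin 3) ⊗ₜ[K] FreeAlgebra.ι K (1 : Fin 3)) =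
      a3 • (FreeAlgebra.ι K (0 : Fin 3) ⊗ₜ[K] FreeAlgebra.ι K (1 : Fin 3)) - b3 • (FreeAlgebra.ι K (1 : Fin 3) ⊗ₜ[K] FreeAlgebra.ι K (0 : Fin 3)))
    (h21 : D (FreeAlgebra.ι K (1 : Fin 3) ⊗ₜ[K] FreeAlgebra.ι K (0 : Fin 3)) =
      (-1 + b3) • (FreeAlgebra.ι K (0 : Fin 3) ⊗ₜ[K] FreeAlgebra.ι K (1 : Fin 3)) + (1 - a3) • (FreeAlgebra.ι K (1 : Fin 3) ⊗ₜ[K] FreeAlgebra.ι K (0 : Fin 3)))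
    (h13 : D (FreeAlgebra.ι K (0 : Fin 3) ⊗ₜ[K] FreeAlgebra.ι K (2 : Fin 3)) =
      a2 • (FreeAlgebra.ι K (0 : Fin 3) ⊗ₜ[K] FreeAlgebra.ι K (2 : Fin 3)) - b2 • (FreeAlgebra.ι K (2 : Fin 3) ⊗ₜ[K] FreeAlgebra.ι K (0 : Fin 3)))
    (h31 : D (FreeAlgebra.ι K (2 : Fin 3) ⊗ₜ[K] FreeAlgebra.ι K (0 : Fin 3)) =
      (-1 + b2) • (FreeAlgebra.ι K (0 : Fin 3) ⊗ₜ[K] FreeAlgebra.ι K (2 : Fin 3)) + (1 - a2) • (FreeAlgebra.ι K (2 : Fin 3) ⊗ₜ[K] FreeAlgebra.ι K (0 : Fin 3)))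
    (h23 : D (FreeAlgebra.ι K (1 : Fin 3) ⊗ₜ[K] FreeAlgebra.ι K (2 : Fin 3)) =
      a1 • (FreeAlgebra.ι K (1 : Fin 3) ⊗ₜ[K] FreeAlgebra.ι K (2 : Fin 3)) - b1 • (FreeAlgebra.ι K (2 : Fin 3) ⊗ₜ[K] FreeAlgebra.ι K (1 : Fin 3)))
    (h32 : D (FreeAlgebra.ι K (2 : Fin 3) ⊗ₜ[K] FreeAlgebra.ι K (1 : Fin 3)) =
      (-1 + b1) • (FreeAlgebra.ι K (1 : Fin 3) ⊗ₜ[K] FreeAlgebra.ι K (2 : Fin 3)) + (1 - a1) • (FreeAlgebra.ι K (2 : Fin 3) ⊗ₜ[K] FreeAlgebra.ι K (1 : Fin 3))) :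
    (∀ u v w : FreeAlgebra K (Fin 3),
        u ∈ Submodule.span K ({FreeAlgebra.ι K (0 : Fin 3), FreeAlgebra.ι K (1 : Fin 3), FreeAlgebra.ι K (2 : Fin 3)} : Set (FreeAlgebra K (Fin 3))) →
        v ∈ Submodule.span K ({FreeAlgebra.ι K (0 : Fin 3), FreeAlgebra.ι K (1 : Fin 3), FreeAlgebra.ι K (2 : Fin 3)} : Set (FreeAlgebra K (Fin 3))) →
        w ∈ Submodule.span K ({FreeAlgebra.ι K (0 : Fin 3), FreeAlgebra.ι K (1 : Fin 3), FreeAlgebra.ι K (2 : Fin 3)} : Set (FreeAlgebra K (Fin 3))) →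
        (D (u ⊗ₜ[K] v) + flipT K (FreeAlgebra K (Fin 3)) (D (v ⊗ₜ[K] u)) = u ⊗ₜ[K] v - v ⊗ₜ[K] u ∧
          DJac K (FreeAlgebra K (Fin 3)) D u v w = -(otimes1 K (FreeAlgebra K (Fin 3)) v (D (u ⊗ₜ[K] w))))) ∧
    IsModifiedDoublePoisson K (FreeAlgebra K (Fin 3)) D := by
  have sq : ∀ x : K, x = 0 ∨ x = 1 → x * x = x := by
    rintro x (rfl | rfl) <;> simp
  have hS := hS_gens a1 a2 a3 b1 b2 b3 (FreeAlgebra.ι K) D h11 h22 h33 h12 h21 h13 h31 h23 h32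
  have hJ := hJ_gens a1 a2 a3 b1 b2 b3 (FreeAlgebra.ι K) (sq _ ha1) (sq _ ha2) (sq _ ha3)
    (sq _ hb1) (sq _ hb2) (sq _ hb3) hacond hbcond D h11 h22 h33 h12 h21 h13 h31 h23 h32
  exact ⟨fun u v w hu hv hw => part1 (FreeAlgebra.ι K) D hS hJ u v w hu hv hw,
    isMDP (freeF K (Fin 3)) hL hS hJ⟩
end

section
/- Let K be an algebraically closed field of characteristic zero and A = K⟨v1,v2,v3⟩ the free associative K-algebra. Let α1, α2, α̃3, β1, β2, β̃3 ∈ {0,1} ⊆ K satisfy α1α2 + α2β̃3 − α1β̃3 − α2 = 0 and β1β2 + β2α̃3 − β1α̃3 − β2 = 0. Then every K-linear map ⟪-,-⟫ : A⊗A → A⊗A satisfying the Leibniz rules with ⟪v_i,v_i⟫ = 0 for i = 1,2,3, ⟪v1,v2⟫ = α̃3·(v1⊗v2) − β̃3·(v2⊗v1), ⟪v2,v1⟫ = (−1+β̃3)·(v1⊗v2) + (1−α̃3)·(v2⊗v1), ⟪v1,v3⟫ = α2·(1⊗(v1v3)) − β2·((v3v1)⊗1), ⟪v3,v1⟫ =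 (−1+β2)·(1⊗(v3v1)) + (1−α2)·((v1v3)⊗1), ⟪v2,v3⟫ = α1·(1⊗(v2v3)) − β1·((v3v2)⊗1), ⟪v3,v2⟫ = (−1+β1)·(1⊗(v3v2)) + (1−α1)·((v2v3)⊗1), is a modified double Poisson bracket on A. -/
open TensorProduct

set_option linter.all false
set_option linter.unusedSimpArgs false

namespace MDP

section general
variable {K : Type*} [Field K] {A : Type*} [Ring A] [Algebra K A]

def e1 (K : Type*) [Field K] {A : Type*} [Ring A] [Algebra K A] (a : A) : (A ⊗[K] A) ⊗[K] A := (a ⊗ₜ 1) ⊗ₜ 1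
def e2 (K : Type*) [Field K] {A : Type*} [Ring A] [Algebra K A] (a : A) : (A ⊗[K] A) ⊗[K] A := (1 ⊗ₜ a) ⊗ₜ 1
def e3 (K : Type*) [Field K] {A : Type*} [Ring A] [Algebra K A] (a : A) : (A ⊗[K] A) ⊗[K] A := (1 ⊗ₜ 1) ⊗ₜ a

def i12 : A ⊗[K] A →ₗ[K] (A ⊗[K] A) ⊗[K] A := (TensorProduct.mk K (A ⊗[K] A) A).flip 1
def i23 : A ⊗[K] A →ₗ[K] (A ⊗[K] A) ⊗[K] A :=
  (TensorProduct.assoc K A A A).symm.toLinearMap ∘ₗ TensorProduct.mk K A (A ⊗[K] A) 1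
def i13 : A ⊗[K] A →ₗ[K] (A ⊗[K] A) ⊗[K] A := otimes1 K A 1

@[simp] lemma i12_tmul (x y : A) : i12 (x ⊗ₜ[K] y) = (x ⊗ₜ y) ⊗ₜ 1 := rfl
@[simp] lemma i23_tmul (x y : A) : i23 (x ⊗ₜ[K] y) = (1 ⊗ₜ x) ⊗ₜ y := rfl
@[simp] lemma i13_tmul (x y : A) : i13 (x ⊗ₜ[K] y) = (x ⊗ₜ 1) ⊗ₜ y := rfl

@[simp] lemma flipT_tmul (x y : A) : flipT K A (x ⊗ₜ[K] y) = y ⊗ₜ x := rfl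

variable (D : A ⊗[K] A →ₗ[K] A ⊗[K] A)

@[simp] lemma dL_tmul (a x y : A) : dL K A D a (x ⊗ₜ y) = D (a ⊗ₜ x) ⊗ₜ y := rfl
@[simp] lemma dR_tmul (a x y : A) : dR K A D a (x ⊗ₜ y) =
  (TensorProduct.assoc K A A A).symm (x ⊗ₜ D (a ⊗ₜ y)) := rfl
@[simp] lemma dLfst_tmul (c x y : A) : dLfst K A D c (x ⊗ₜ y) = otimes1 K A y (D (x ⊗ₜ c)) := by
  simp only [dLfst, swap23, otimes1, LinearMap.comp_apply, LinearMap.rTensor_tmul]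
  change _ = LinearMap.rTensor A _ (D (x ⊗ₜ c))
  have : ((TensorProduct.mk K A A).flip c) x = x ⊗ₜ c := rfl
  rw [this]
  induction D (x ⊗ₜ c) with
  | zero => simp
  | add p q hp hq => simp only [add_tmul, map_add, hp, hq]
  | tmul p q => simp

lemma assoc_symm_eq (x : A) (w : A ⊗[K] A) :
    (TensorProduct.assoc K A A A).symm (x ⊗ₜ w) = e1 K x * i23 w := by
  induction w with
  | zero => simp
  | add p q hp hq => simp only [tmul_add, map_add, hp, hq, mul_add]
  | tmul p q => simp [e1]

lemma tmul_eq (x : A) (w : A ⊗[K] A) : w ⊗ₜ[K] x = e3 K x * i12 w := by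
  induction w with
  | zero => simp
  | add p q hp hq => simp only [add_tmul, map_add, hp, hq, mul_add]
  | tmul p q => simp [e3]

lemma otimes1_eq (x : A) (w : A ⊗[K] A) : otimes1 K A x w = e2 K x * i13 w := by
  induction w with
  | zero => simp
  | add p q hp hq => simp only [map_add, hp, hq, mul_add]
  | tmul p q => simp [e2, otimes1]

lemma i12_mul (v w : A ⊗[K] A) : i12 (v * w) = i12 v * i12 w := by
  simp [i12]
lemma i13_mul (v w : A ⊗[K] A) : i13 (v * w) = i13 v * i13 w := by
  induction v with
  | zero => simp
  | add p q hp hq => simp only [map_add, hp, hq, add_mul]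
  | tmul p q =>
    induction w with
    | zero => simp
    | add p q hp hq => simp only [map_add, hp, hq, mul_add]
    | tmul p q => simp
lemma i23_mul (v w : A ⊗[K] A) : i23 (v * w) = i23 v * i23 w := by
  induction v with
  | zero => simp
  | add p q hp hq => simp only [map_add, hp, hq, add_mul]
  | tmul p q =>
    induction w with
    | zero => simp
    | add p q hp hq => simp only [map_add, hp, hq, mul_add]
    | tmul p q => simp

lemma c12 (x y : A) : e1 K x * e2 K y = e2 K y * e1 K x := by simp [e1, e2]
lemma c13 (x y : A) : e1 K x * e3 K y = e3 K y * e1 K x := by simp [e1, e3]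
lemma c23 (x y : A) : e2 K x * e3 K y = e3 K y * e2 K x := by simp [e2, e3]
lemma ci12 (x : A) (w : A ⊗[K] A) : i12 w * e3 K x = e3 K x * i12 w := by
  induction w with
  | zero => simp
  | add p q hp hq => simp only [map_add, hp, hq, mul_add, add_mul]
  | tmul p q => simp [e3]
lemma ci13 (x : A) (w : A ⊗[K] A) : i13 w * e2 K x = e2 K x * i13 w := by
  induction w with
  | zero => simp
  | add p q hp hq => simp only [map_add, hp, hq, mul_add, add_mul]
  | tmul p q => simp [e2]
lemma ci23 (x : A) (w : A ⊗[K] A) : i23 w * e1 K x = e1 K x * i23 w := by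
  induction w with
  | zero => simp
  | add p q hp hq => simp only [map_add, hp, hq, mul_add, add_mul]
  | tmul p q => simp [e1]

lemma e1_mul (x y : A) : e1 K (x * y) = e1 K x * e1 K y := by simp [e1]
lemma e2_mul (x y : A) : e2 K (x * y) = e2 K x * e2 K y := by simp [e2]
lemma e3_mul (x y : A) : e3 K (x * y) = e3 K x * e3 K y := by simp [e3]
lemma i12_l (x : A) : i12 (x ⊗ₜ[K] (1:A)) = e1 K x := rfl
lemma i12_r (x : A) : i12 ((1:A) ⊗ₜ[K] x) = e2 K x := rfl
lemma i13_l (x : A) : i13 (x ⊗ₜ[K] (1:A)) = e1 K x := rfl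
lemma i13_r (x : A) : i13 ((1:A) ⊗ₜ[K] x) = e3 K x := rfl
lemma i23_l (x : A) : i23 (x ⊗ₜ[K] (1:A)) = e2 K x := rfl
lemma i23_r (x : A) : i23 ((1:A) ⊗ₜ[K] x) = e3 K x := rfl
lemma i12_t (x y : A) : i12 (x ⊗ₜ[K] y) = e1 K x * e2 K y := by simp [e1, e2]
lemma i13_t (x y : A) : i13 (x ⊗ₜ[K] y) = e1 K x * e3 K y := by simp [e1, e3]
lemma i23_t (x y : A) : i23 (x ⊗ₜ[K] y) = e2 K x * e3 K y := by simp [e2, e3]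

lemma dL_t (a x y : A) : dL K A D a (x ⊗ₜ y) = e3 K y * i12 (D (a ⊗ₜ x)) := by
  rw [dL_tmul, tmul_eq]
lemma dR_t (a x y : A) : dR K A D a (x ⊗ₜ y) = e1 K x * i23 (D (a ⊗ₜ y)) := by
  rw [dR_tmul, assoc_symm_eq]
lemma dF_t (c x y : A) : dLfst K A D c (x ⊗ₜ y) = e2 K y * i13 (D (x ⊗ₜ c)) := by
  rw [dLfst_tmul, otimes1_eq]


lemma c12' (x y : A) (z) : e1 K x * (e2 K y * z) = e2 K y * (e1 K x * z) := by
  rw [← mul_assoc, c12, mul_assoc]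
lemma c13' (x y : A) (z) : e1 K x * (e3 K y * z) = e3 K y * (e1 K x * z) := by
  rw [← mul_assoc, c13, mul_assoc]
lemma c23' (x y : A) (z) : e2 K x * (e3 K y * z) = e3 K y * (e2 K x * z) := by
  rw [← mul_assoc, c23, mul_assoc]
lemma ci12' (x : A) (w : A ⊗[K] A) (z) : i12 w * (e3 K x * z) = e3 K x * (i12 w * z) := by
  rw [← mul_assoc, ci12, mul_assoc]
lemma ci13' (x : A) (w : A ⊗[K] A) (z) : i13 w * (e2 K x * z) = e2 K x * (i13 w * z) := by
  rw [← mul_assoc, ci13, mul_assoc]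
lemma ci23' (x : A) (w : A ⊗[K] A) (z) : i23 w * (e1 K x * z) = e1 K x * (i23 w * z) := by
  rw [← mul_assoc, ci23, mul_assoc]

lemma D_one_right {D : A ⊗[K] A →ₗ[K] A ⊗[K] A} (hL : LeibnizRules K A D) (a : A) :
    D (a ⊗ₜ 1) = 0 := by
  have := hL.1 a 1 1
  simpa [← Algebra.TensorProduct.one_def] using this
lemma D_one_left {D : A ⊗[K] A →ₗ[K] A ⊗[K] A} (hL : LeibnizRules K A D) (a : A) :
    D (1 ⊗ₜ a) = 0 := by
  have := hL.2 1 1 a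
  simpa [← Algebra.TensorProduct.one_def] using this

lemma e_one1 : e1 K (1:A) = 1 := rfl
lemma e_one2 : e2 K (1:A) = 1 := rfl
lemma e_one3 : e3 K (1:A) = 1 := rfl

/-- Leibniz-type rules for the three extensions of the bracket to double tensors. -/
theorem leib {D : A ⊗[K] A →ₗ[K] A ⊗[K] A} (hL : LeibnizRules K A D) (a b : A) (w : A ⊗[K] A) :
    (dL K A D a ((b ⊗ₜ 1) * w) = e1 K b * dL K A D a w + i12 (D (a ⊗ₜ b)) * i23 w) ∧
    (dL K A D a (w * (1 ⊗ₜ b)) = dL K A D a w * e3 K b) ∧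
    (dL K A D (a * b) w = e2 K a * dL K A D b w + dL K A D a w * e1 K b) ∧
    (dL K A D a ((1 ⊗ₜ b) * w) = e3 K b * dL K A D a w) ∧
    (dL K A D a (w * (b ⊗ₜ 1)) = i13 w * i12 (D (a ⊗ₜ b)) + dL K A D a w * e2 K b) ∧
    (dR K A D a ((b ⊗ₜ 1) * w) = e1 K b * dR K A D a w) ∧
    (dR K A D a (w * (1 ⊗ₜ b)) = i12 w * i23 (D (a ⊗ₜ b)) + dR K A D a w * e3 K b) ∧
    (dR K A D (a * b) w = e3 K a * dR K A D b w + dR K A D a w * e2 K b) ∧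
    (dR K A D a ((1 ⊗ₜ b) * w) = e2 K b * dR K A D a w + i23 (D (a ⊗ₜ b)) * i13 w) ∧
    (dR K A D a (w * (b ⊗ₜ 1)) = dR K A D a w * e1 K b) ∧
    (dLfst K A D (a * b) w = e1 K a * dLfst K A D b w + dLfst K A D a w * e3 K b) ∧
    (dLfst K A D a ((1 ⊗ₜ b) * w) = e2 K b * dLfst K A D a w) ∧
    (dLfst K A D a (w * (b ⊗ₜ 1)) = i23 (flipT K A w) * i13 (D (b ⊗ₜ a)) + dLfst K A D a w * e1 K b) ∧
    (dLfst K A D a ((b ⊗ₜ 1) * w) = e3 K b * dLfst K A D a w + i13 (D (b ⊗ₜ a)) * i12 w) ∧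
    (dLfst K A D a (w * (1 ⊗ₜ b)) = dLfst K A D a w * e2 K b) := by
  refine ⟨?_, ?_, ?_, ?_, ?_, ?_, ?_, ?_, ?_, ?_, ?_, ?_, ?_, ?_, ?_⟩ <;>
  induction w with
  | zero => simp
  | add p q hp hq => simp only [map_add, hp, hq, mul_add, add_mul]; try abel
  | tmul x y =>
    simp only [Algebra.TensorProduct.tmul_mul_tmul, one_mul, mul_one, dL_t, dR_t, dF_t, flipT_tmul,
      hL.1, hL.2, map_add, i12_mul, i13_mul, i23_mul, i12_t, i13_t, i23_t, e_one1, e_one2, e_one3,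
      e1_mul, e2_mul, e3_mul, mul_add, add_mul, mul_assoc, c12, c13, c23, ci12, ci13, ci23,
      c12', c13', c23', ci12', ci13', ci23']
    first
      | done
      | (rw [← c13, ci23']; done)
      | abel

lemma dL_cl {D : A ⊗[K] A →ₗ[K] A ⊗[K] A} (hL : LeibnizRules K A D) (a c : A) (w : A ⊗[K] A) :
    dL K A D a ((c ⊗ₜ 1) * w) = e1 K c * dL K A D a w + i12 (D (a ⊗ₜ c)) * i23 w :=
  (leib hL a c w).1

lemma dL_rr {D : A ⊗[K] A →ₗ[K] A ⊗[K] A} (hL : LeibnizRules K A D) (a d : A) (w : A ⊗[K] A) :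
    dL K A D a (w * (1 ⊗ₜ d)) = dL K A D a w * e3 K d :=
  (leib hL a d w).2.1

lemma dL_mul {D : A ⊗[K] A →ₗ[K] A ⊗[K] A} (hL : LeibnizRules K A D) (a b : A) (w : A ⊗[K] A) :
    dL K A D (a * b) w = e2 K a * dL K A D b w + dL K A D a w * e1 K b :=
  (leib hL a b w).2.2.1

lemma dL_lr {D : A ⊗[K] A →ₗ[K] A ⊗[K] A} (hL : LeibnizRules K A D) (a b : A) (w : A ⊗[K] A) :
    dL K A D a ((1 ⊗ₜ b) * w) = e3 K b * dL K A D a w :=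
  (leib hL a b w).2.2.2.1

lemma dL_rl {D : A ⊗[K] A →ₗ[K] A ⊗[K] A} (hL : LeibnizRules K A D) (a b : A) (w : A ⊗[K] A) :
    dL K A D a (w * (b ⊗ₜ 1)) = i13 w * i12 (D (a ⊗ₜ b)) + dL K A D a w * e2 K b :=
  (leib hL a b w).2.2.2.2.1

lemma dR_cl {D : A ⊗[K] A →ₗ[K] A ⊗[K] A} (hL : LeibnizRules K A D) (b c : A) (w : A ⊗[K] A) :
    dR K A D b ((c ⊗ₜ 1) * w) = e1 K c * dR K A D b w :=
  (leib hL b c w).2.2.2.2.2.1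

lemma dR_rr {D : A ⊗[K] A →ₗ[K] A ⊗[K] A} (hL : LeibnizRules K A D) (b d : A) (w : A ⊗[K] A) :
    dR K A D b (w * (1 ⊗ₜ d)) = i12 w * i23 (D (b ⊗ₜ d)) + dR K A D b w * e3 K d :=
  (leib hL b d w).2.2.2.2.2.2.1

lemma dR_mul {D : A ⊗[K] A →ₗ[K] A ⊗[K] A} (hL : LeibnizRules K A D) (a b : A) (w : A ⊗[K] A) :
    dR K A D (a * b) w = e3 K a * dR K A D b w + dR K A D a w * e2 K b :=
  (leib hL a b w).2.2.2.2.2.2.2.1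

lemma dR_lr {D : A ⊗[K] A →ₗ[K] A ⊗[K] A} (hL : LeibnizRules K A D) (b a : A) (w : A ⊗[K] A) :
    dR K A D b ((1 ⊗ₜ a) * w) = e2 K a * dR K A D b w + i23 (D (b ⊗ₜ a)) * i13 w :=
  (leib hL b a w).2.2.2.2.2.2.2.2.1

lemma dR_rl {D : A ⊗[K] A →ₗ[K] A ⊗[K] A} (hL : LeibnizRules K A D) (b a : A) (w : A ⊗[K] A) :
    dR K A D b (w * (a ⊗ₜ 1)) = dR K A D b w * e1 K a :=
  (leib hL b a w).2.2.2.2.2.2.2.2.2.1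

lemma dF_mul {D : A ⊗[K] A →ₗ[K] A ⊗[K] A} (hL : LeibnizRules K A D) (c d : A) (w : A ⊗[K] A) :
    dLfst K A D (c * d) w = e1 K c * dLfst K A D d w + dLfst K A D c w * e3 K d :=
  (leib hL c d w).2.2.2.2.2.2.2.2.2.2.1

lemma dF_lr {D : A ⊗[K] A →ₗ[K] A ⊗[K] A} (hL : LeibnizRules K A D) (c a : A) (w : A ⊗[K] A) :
    dLfst K A D c ((1 ⊗ₜ a) * w) = e2 K a * dLfst K A D c w :=
  (leib hL c a w).2.2.2.2.2.2.2.2.2.2.2.1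

lemma dF_rl {D : A ⊗[K] A →ₗ[K] A ⊗[K] A} (hL : LeibnizRules K A D) (c a : A) (w : A ⊗[K] A) :
    dLfst K A D c (w * (a ⊗ₜ 1)) = i23 (flipT K A w) * i13 (D (a ⊗ₜ c)) + dLfst K A D c w * e1 K a :=
  (leib hL c a w).2.2.2.2.2.2.2.2.2.2.2.2.1

lemma dF_cl {D : A ⊗[K] A →ₗ[K] A ⊗[K] A} (hL : LeibnizRules K A D) (c b : A) (w : A ⊗[K] A) :
    dLfst K A D c ((b ⊗ₜ 1) * w) = e3 K b * dLfst K A D c w + i13 (D (b ⊗ₜ c)) * i12 w :=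
  (leib hL c b w).2.2.2.2.2.2.2.2.2.2.2.2.2.1

lemma dF_rr {D : A ⊗[K] A →ₗ[K] A ⊗[K] A} (hL : LeibnizRules K A D) (c b : A) (w : A ⊗[K] A) :
    dLfst K A D c (w * (1 ⊗ₜ b)) = dLfst K A D c w * e2 K b :=
  (leib hL c b w).2.2.2.2.2.2.2.2.2.2.2.2.2.2

lemma DJac_c {D : A ⊗[K] A →ₗ[K] A ⊗[K] A} (hL : LeibnizRules K A D) (a b c d : A) : DJac K A D a b (c * d) =
    e1 K c * DJac K A D a b d + DJac K A D a b c * e3 K d := by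
  simp only [DJac, hL.1, map_add, dL_cl hL, dL_rr hL, dR_cl hL, dR_rr hL, dF_mul hL, mul_sub, sub_mul]
  abel

lemma DJac_b {D : A ⊗[K] A →ₗ[K] A ⊗[K] A} (hL : LeibnizRules K A D) (a b b' c : A) : DJac K A D a (b * b') c =
    e3 K b * DJac K A D a b' c + DJac K A D a b c * e2 K b' := by
  simp only [DJac, hL.1, hL.2, map_add, dL_lr hL, dL_rl hL, dR_mul hL, dF_cl hL, dF_rr hL, mul_sub, sub_mul]
  abel

lemma DJac_a {D : A ⊗[K] A →ₗ[K] A ⊗[K] A} (hL : LeibnizRules K A D) (a a' b c : A) : DJac K A D (a * a') b c =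
    e2 K a * DJac K A D a' b c + DJac K A D a b c * e1 K a'
      - i23 (D (b ⊗ₜ a) + flipT K A (D (a ⊗ₜ b))) * i13 (D (a' ⊗ₜ c)) := by
  simp only [DJac, hL.2, map_add, dL_mul hL, dR_lr hL, dR_rl hL, dF_lr hL, dF_rl hL, mul_sub, sub_mul,
    add_mul]
  abel

/-- Triple multiplication. -/
def mu : (A ⊗[K] A) ⊗[K] A →ₗ[K] A := LinearMap.mul' K A ∘ₗ LinearMap.rTensor A (LinearMap.mul' K A)

@[simp] lemma mu_tmul (x y z : A) : mu ((x ⊗ₜ[K] y) ⊗ₜ[K] z) = x * y * z := rfl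

lemma mu_32 (b : A) (U : (A ⊗[K] A) ⊗[K] A) : mu (e3 K b * U) = mu (U * e2 K b) := by
  induction U with
  | zero => simp
  | add p q hp hq => simp only [mul_add, add_mul, map_add, hp, hq]
  | tmul w z =>
    induction w with
    | zero => simp
    | add p q hp hq => simp only [mul_add, add_mul, map_add, hp, hq, add_tmul]
    | tmul x y => simp [e3, e2, mul_assoc]

lemma mu_21 (b : A) (U : (A ⊗[K] A) ⊗[K] A) : mu (e2 K b * U) = mu (U * e1 K b) := by
  induction U with
  | zero => simp
  | add p q hp hq => simp only [mul_add, add_mul, map_add, hp, hq]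
  | tmul w z =>
    induction w with
    | zero => simp
    | add p q hp hq => simp only [mul_add, add_mul, map_add, hp, hq, add_tmul]
    | tmul x y => simp [e1, e2, mul_assoc]

lemma mu_ins (v w : A ⊗[K] A) : mu (i13 v * i12 w) = mu (i23 w * i13 v) := by
  induction w with
  | zero => simp
  | add p q hp hq => simp only [mul_add, add_mul, map_add, hp, hq]
  | tmul x y =>
    induction v with
    | zero => simp
    | add p q hp hq => simp only [mul_add, add_mul, map_add, hp, hq]
    | tmul x y => simp [mul_assoc]

lemma mu_i12 (w : A ⊗[K] A) (y : A) : mu (i12 w * e3 K y) = LinearMap.mul' K A w * y := by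
  induction w with
  | zero => simp
  | add p q hp hq => simp only [mul_add, add_mul, map_add, hp, hq]
  | tmul p q => simp [e3]
lemma mu_i23 (w : A ⊗[K] A) (y : A) : mu (e1 K y * i23 w) = y * LinearMap.mul' K A w := by
  induction w with
  | zero => simp
  | add p q hp hq => simp only [mul_add, map_add, hp, hq]
  | tmul p q => simp [e1, mul_assoc]
lemma mul_l (w : A ⊗[K] A) (y : A) : LinearMap.mul' K A ((y ⊗ₜ 1) * w) = y * LinearMap.mul' K A w := by
  induction w with
  | zero => simp
  | add p q hp hq => simp only [mul_add, map_add, hp, hq]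
  | tmul p q => simp [mul_assoc]
lemma mul_r (w : A ⊗[K] A) (y : A) : LinearMap.mul' K A (w * (1 ⊗ₜ y)) = LinearMap.mul' K A w * y := by
  induction w with
  | zero => simp
  | add p q hp hq => simp only [add_mul, map_add, hp, hq]
  | tmul p q => simp [mul_assoc]
lemma mul_m (w : A ⊗[K] A) (y : A) :
    LinearMap.mul' K A ((1 ⊗ₜ y) * w) = LinearMap.mul' K A (w * (y ⊗ₜ 1)) := by
  induction w with
  | zero => simp
  | add p q hp hq => simp only [mul_add, add_mul, map_add, hp, hq]
  | tmul p q => simp [mul_assoc]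
lemma mul_m' (w : A ⊗[K] A) (y : A) :
    LinearMap.mul' K A ((1 ⊗ₜ y) * w) = mu (e2 K y * i13 w) := by
  induction w with
  | zero => simp
  | add p q hp hq => simp only [mul_add, map_add, hp, hq]
  | tmul p q => simp [mul_assoc, e2]

lemma br_right {D : A ⊗[K] A →ₗ[K] A ⊗[K] A} (hL : LeibnizRules K A D) (a : A) (w : A ⊗[K] A) :
    br K A D a (LinearMap.mul' K A w) = mu (dL K A D a w + dR K A D a w) := by
  induction w with
  | zero => simp [br]
  | add p q hp hq =>
    simp only [br, map_add, tmul_add] at *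
    rw [hp, hq]; abel
  | tmul x y =>
    simp only [br, LinearMap.mul'_apply, hL.1, map_add, dL_t, dR_t, mul_l, mul_r, mu_i23, ← ci12, mu_i12]
    abel

lemma br_left {D : A ⊗[K] A →ₗ[K] A ⊗[K] A} (hL : LeibnizRules K A D) (c : A) (w : A ⊗[K] A) :
    br K A D (LinearMap.mul' K A w) c = mu (dLfst K A D c w + dLfst K A D c (flipT K A w)) := by
  induction w with
  | zero => simp [br]
  | add p q hp hq =>
    simp only [br, map_add, add_tmul] at *
    rw [hp, hq]; abel
  | tmul x y =>
    simp only [br, LinearMap.mul'_apply, hL.2, map_add, dF_t, flipT_tmul, ← mul_m, mul_m']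
    abel

lemma jac_eq {D : A ⊗[K] A →ₗ[K] A ⊗[K] A} (hL : LeibnizRules K A D) (a b c : A) :
    br K A D a (br K A D b c) - br K A D b (br K A D a c) - br K A D (br K A D a b) c =
    mu (DJac K A D a b c - DJac K A D b a c
      - dLfst K A D c (D (b ⊗ₜ a) + flipT K A (D (a ⊗ₜ b)))) := by
  have h1 := br_right hL a (D (b ⊗ₜ c))
  have h2 := br_right hL b (D (a ⊗ₜ c))
  have h3 := br_left hL c (D (a ⊗ₜ b))
  change br K A D a (br K A D b c) = _ at h1
  change br K A D b (br K A D a c) = _ at h2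
  change br K A D (br K A D a b) c = _ at h3
  rw [h1, h2, h3]
  simp only [DJac, map_add, map_sub]
  abel

/-- Abstract criterion. -/
theorem criterion {D : A ⊗[K] A →ₗ[K] A ⊗[K] A} (hL : LeibnizRules K A D) (X : A →ₗ[K] A ⊗[K] A)
    (hS : ∀ a b, D (a ⊗ₜ b) + flipT K A (D (b ⊗ₜ a)) =
      X a * (1 ⊗ₜ b) - (b ⊗ₜ 1) * X a - (1 ⊗ₜ a) * flipT K A (X b) + flipT K A (X b) * (a ⊗ₜ 1))
    (hJ : ∀ a c, ∃ U, ∀ b, DJac K A D a b c =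
      - (i23 (X b) * i13 (D (a ⊗ₜ c))) + e3 K b * U - U * e2 K b) :
    IsModifiedDoublePoisson K A D := by
  have hff : ∀ w : A ⊗[K] A, flipT K A (flipT K A w) = w := fun w => by
    simp [flipT]
  have hmf : ∀ a b, br K A D a b + br K A D b a - LinearMap.mul' K A (D (a ⊗ₜ b) + flipT K A (D (b ⊗ₜ a)))
      ∈ commutatorSpan K A := by
    intro a b
    simp only [br, map_add, add_sub_add_left_eq_sub]
    induction D (b ⊗ₜ a) with
    | zero => simp
    | add p q hp hq =>
      simp only [map_add]
      convert add_mem hp hq using 1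
      abel
    | tmul x y => exact Submodule.subset_span ⟨x, y, by simp⟩
  refine ⟨hL, fun a b => ?_, fun a b c => ?_⟩
  · have h := hmf a b
    have h2 : LinearMap.mul' K A (D (a ⊗ₜ b) + flipT K A (D (b ⊗ₜ a))) ∈ commutatorSpan K A := by
      rw [hS]
      refine Submodule.subset_span ⟨LinearMap.mul' K A (X a), b, ?_⟩
      simp only [map_add, map_sub, mul_l, mul_r, mul_m]
      abel
    simpa using add_mem h h2
  · rw [jac_eq hL, hS]
    obtain ⟨U, hU⟩ := hJ a c
    obtain ⟨V, hV⟩ := hJ b c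
    rw [hU, hV]
    simp only [map_add, map_sub, map_neg, dF_rr hL, dF_cl hL, dF_lr hL, dF_rl hL, mu_32, mu_21, mu_ins, hff]
    abel

end general
end MDP

namespace MDP
section free
variable {K : Type*} [Field K] {A : Type*} [Ring A] [Algebra K A]

lemma flipT_mul (v w : A ⊗[K] A) : flipT K A (v * w) = flipT K A v * flipT K A w := by
  induction v with
  | zero => simp
  | add p q hp hq => simp only [map_add, hp, hq, add_mul]
  | tmul p q =>
    induction w with
    | zero => simp
    | add p q hp hq => simp only [map_add, hp, hq, mul_add]
    | tmul p q => simp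

lemma dL_add (D : A ⊗[K] A →ₗ[K] A ⊗[K] A) (a b : A) : dL K A D (a + b) = dL K A D a + dL K A D b := by
  simp [dL, LinearMap.comp_add, LinearMap.rTensor_add]
lemma dR_add (D : A ⊗[K] A →ₗ[K] A ⊗[K] A) (a b : A) : dR K A D (a + b) = dR K A D a + dR K A D b := by
  simp [dR, LinearMap.comp_add, LinearMap.lTensor_add]
lemma dF_add (D : A ⊗[K] A →ₗ[K] A ⊗[K] A) (a b : A) :
    dLfst K A D (a + b) = dLfst K A D a + dLfst K A D b := by
  simp [dLfst, LinearMap.comp_add, LinearMap.rTensor_add]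

lemma D_alg_left {D : A ⊗[K] A →ₗ[K] A ⊗[K] A} (hL : LeibnizRules K A D) (r : K) (a : A) :
    D (algebraMap K A r ⊗ₜ a) = 0 := by
  rw [Algebra.algebraMap_eq_smul_one, ← smul_tmul', map_smul, D_one_left hL, smul_zero]
lemma D_alg_right {D : A ⊗[K] A →ₗ[K] A ⊗[K] A} (hL : LeibnizRules K A D) (r : K) (a : A) :
    D (a ⊗ₜ algebraMap K A r) = 0 := by
  rw [Algebra.algebraMap_eq_smul_one, tmul_smul, map_smul, D_one_right hL, smul_zero]
lemma dL_alg {D : A ⊗[K] A →ₗ[K] A ⊗[K] A} (hL : LeibnizRules K A D) (r : K) :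
    dL K A D (algebraMap K A r) = 0 := by
  ext x y; simp [D_alg_left hL]
lemma dR_alg {D : A ⊗[K] A →ₗ[K] A ⊗[K] A} (hL : LeibnizRules K A D) (r : K) :
    dR K A D (algebraMap K A r) = 0 := by
  ext x y; simp [D_alg_left hL]
lemma dF_alg {D : A ⊗[K] A →ₗ[K] A ⊗[K] A} (hL : LeibnizRules K A D) (r : K) :
    dLfst K A D (algebraMap K A r) = 0 := by
  ext x y; simp [D_alg_right hL]

lemma e2_add (x y : A) : e2 K (x + y) = e2 K x + e2 K y := by simp [e2, tmul_add, add_tmul]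
lemma e3_add (x y : A) : e3 K (x + y) = e3 K x + e3 K y := by simp [e3, tmul_add]
lemma e2_alg (r : K) : e2 K (algebraMap K A r) = algebraMap K _ r := by
  simp [e2, Algebra.algebraMap_eq_smul_one, tmul_smul, ← smul_tmul', Algebra.TensorProduct.one_def]
lemma e3_alg (r : K) : e3 K (algebraMap K A r) = algebraMap K _ r := by
  simp [e3, Algebra.algebraMap_eq_smul_one, tmul_smul, Algebra.TensorProduct.one_def]

lemma T_mul_neg (x y : (A ⊗[K] A) ⊗[K] A) : x * (-y) = -(x * y) := mul_neg x y
lemma T_neg_mul (x y : (A ⊗[K] A) ⊗[K] A) : (-x) * y = -(x * y) := neg_mul x y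

lemma clr (x y : A) : ((1:A) ⊗ₜ[K] x) * (y ⊗ₜ[K] (1:A)) = (y ⊗ₜ[K] (1:A)) * ((1:A) ⊗ₜ[K] x) := by simp
lemma clr' (x y : A) (z) : ((1:A) ⊗ₜ[K] x) * ((y ⊗ₜ[K] (1:A)) * z) =
    (y ⊗ₜ[K] (1:A)) * (((1:A) ⊗ₜ[K] x) * z) := by
  rw [← mul_assoc, clr, mul_assoc]
lemma lmul (x y : A) : ((x * y) ⊗ₜ[K] (1:A)) = (x ⊗ₜ[K] (1:A)) * (y ⊗ₜ[K] (1:A)) := by simp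
lemma rmul (x y : A) : ((1:A) ⊗ₜ[K] (x * y)) = ((1:A) ⊗ₜ[K] x) * ((1:A) ⊗ₜ[K] y) := by simp

variable {ι : Type*}


def rho (hv : ι → K) : FreeAlgebra K ι →ₐ[K] Matrix (Fin 2) (Fin 2) (FreeAlgebra K ι ⊗[K] FreeAlgebra K ι) :=
  FreeAlgebra.lift K fun i =>
    !![1 ⊗ₜ FreeAlgebra.ι K i, hv i • (FreeAlgebra.ι K i ⊗ₜ 1 + 1 ⊗ₜ FreeAlgebra.ι K i);
       0, FreeAlgebra.ι K i ⊗ₜ 1]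

lemma rho_diag (hv : ι → K) (a : FreeAlgebra K ι) :
    rho hv a 0 0 = 1 ⊗ₜ a ∧ rho hv a 1 0 = 0 ∧ rho hv a 1 1 = a ⊗ₜ 1 := by
  induction a using FreeAlgebra.induction with
  | grade0 r =>
    simp [Matrix.algebraMap_matrix_apply, Algebra.TensorProduct.algebraMap_apply]
    simp [Algebra.algebraMap_eq_smul_one, tmul_smul, ← smul_tmul']
  | grade1 i => simp [rho]
  | mul a b ha hb => simp [Matrix.mul_apply, Fin.sum_univ_two, ha, hb]
  | add a b ha hb => simp [ha, hb, tmul_add, add_tmul]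

def X (hv : ι → K) : FreeAlgebra K ι →ₗ[K] FreeAlgebra K ι ⊗[K] FreeAlgebra K ι where
  toFun a := rho hv a 0 1
  map_add' a b := by simp
  map_smul' r a := by simp

lemma X_ι (hv : ι → K) (i : ι) : X hv (FreeAlgebra.ι K i) =
    hv i • (FreeAlgebra.ι K i ⊗ₜ 1 + 1 ⊗ₜ FreeAlgebra.ι K i) := by
  simp [X, rho]
lemma X_mul (hv : ι → K) (a b : FreeAlgebra K ι) : X hv (a * b) = (1 ⊗ₜ a) * X hv b + X hv a * (b ⊗ₜ 1) := by
  simp [X, Matrix.mul_apply, Fin.sum_univ_two, rho_diag]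
lemma X_alg (hv : ι → K) (r : K) : X hv (algebraMap K _ r) = 0 := by
  simp [X, Matrix.algebraMap_matrix_apply]

theorem freeS {D : FreeAlgebra K ι ⊗[K] FreeAlgebra K ι →ₗ[K] FreeAlgebra K ι ⊗[K] FreeAlgebra K ι}
    (hL : LeibnizRules K (FreeAlgebra K ι) D) (hv : ι → K)
    (hgen : ∀ i j, D (FreeAlgebra.ι K i ⊗ₜ FreeAlgebra.ι K j) +
        flipT K _ (D (FreeAlgebra.ι K j ⊗ₜ FreeAlgebra.ι K i)) =
      X hv (FreeAlgebra.ι K i) * (1 ⊗ₜ FreeAlgebra.ι K j) - (FreeAlgebra.ι K j ⊗ₜ 1) * X hv (FreeAlgebra.ι K i)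
      - (1 ⊗ₜ FreeAlgebra.ι K i) * flipT K _ (X hv (FreeAlgebra.ι K j))
      + flipT K _ (X hv (FreeAlgebra.ι K j)) * (FreeAlgebra.ι K i ⊗ₜ 1)) (a b : FreeAlgebra K ι) :
    D (a ⊗ₜ b) + flipT K _ (D (b ⊗ₜ a)) =
      X hv a * (1 ⊗ₜ b) - (b ⊗ₜ 1) * X hv a - (1 ⊗ₜ a) * flipT K _ (X hv b)
        + flipT K _ (X hv b) * (a ⊗ₜ 1) := by
  induction a using FreeAlgebra.induction generalizing b with
  | grade0 r =>
    rw [D_alg_left hL, D_alg_right hL, X_alg]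
    simp [Algebra.algebraMap_eq_smul_one, tmul_smul, ← smul_tmul', ← Algebra.TensorProduct.one_def]
  | add a a' ha ha' =>
    have h1 := ha b
    have h2 := ha' b
    simp only [add_tmul, tmul_add, map_add, add_mul, mul_add] at *
    rw [add_add_add_comm, h1, h2]; abel
  | mul a a' ha ha' =>
    have h : D ((a * a') ⊗ₜ b) + flipT K _ (D (b ⊗ₜ (a * a'))) =
      (1 ⊗ₜ a) * (D (a' ⊗ₜ b) + flipT K _ (D (b ⊗ₜ a'))) +
      (D (a ⊗ₜ b) + flipT K _ (D (b ⊗ₜ a))) * (a' ⊗ₜ 1) := by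
      rw [hL.1, hL.2]
      simp only [map_add, flipT_mul, flipT_tmul, mul_add, add_mul]; abel
    rw [h, ha b, ha' b]
    simp only [X_mul, lmul, rmul, mul_add, add_mul, mul_sub, sub_mul, mul_assoc, clr, clr']
    abel
  | grade1 i =>
    induction b using FreeAlgebra.induction with
    | grade0 r =>
      rw [D_alg_left hL, D_alg_right hL, X_alg]
      simp [Algebra.algebraMap_eq_smul_one, tmul_smul, ← smul_tmul', ← Algebra.TensorProduct.one_def]
    | grade1 j => exact hgen i j
    | add b b' h1 h2 =>
      simp only [add_tmul, tmul_add, map_add, add_mul, mul_add] at *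
      rw [add_add_add_comm, h1, h2]; abel
    | mul b b' h1 h2 =>
      have h : ∀ a, D (a ⊗ₜ (b * b')) + flipT K _ (D ((b * b') ⊗ₜ a)) =
        (b ⊗ₜ 1) * (D (a ⊗ₜ b') + flipT K _ (D (b' ⊗ₜ a))) +
        (D (a ⊗ₜ b) + flipT K _ (D (b ⊗ₜ a))) * (1 ⊗ₜ b') := by
        intro a
        rw [hL.1, hL.2]
        simp only [map_add, flipT_mul, flipT_tmul, mul_add, add_mul]; abel
      rw [h, h1, h2]
      simp only [X_mul, map_add, flipT_mul, flipT_tmul, lmul, rmul, mul_add, add_mul, mul_sub, sub_mul, mul_assoc, clr, clr']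
      abel

theorem freeJgen {D : FreeAlgebra K ι ⊗[K] FreeAlgebra K ι →ₗ[K] FreeAlgebra K ι ⊗[K] FreeAlgebra K ι}
    (hL : LeibnizRules K (FreeAlgebra K ι) D) (hv : ι → K) (s : K) (a : FreeAlgebra K ι)
    (hgen : ∀ j k, DJac K _ D a (FreeAlgebra.ι K j) (FreeAlgebra.ι K k) =
      - (i23 (X hv (FreeAlgebra.ι K j)) * i13 (D (a ⊗ₜ FreeAlgebra.ι K k)))
      + e3 K (FreeAlgebra.ι K j) * (s • i13 (D (a ⊗ₜ FreeAlgebra.ι K k)))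
      - (s • i13 (D (a ⊗ₜ FreeAlgebra.ι K k))) * e2 K (FreeAlgebra.ι K j)) (b c : FreeAlgebra K ι) :
    DJac K _ D a b c = - (i23 (X hv b) * i13 (D (a ⊗ₜ c)))
      + e3 K b * (s • i13 (D (a ⊗ₜ c))) - (s • i13 (D (a ⊗ₜ c))) * e2 K b := by
  induction b using FreeAlgebra.induction generalizing c with
  | grade0 r =>
    simp only [DJac, D_alg_left hL, D_alg_right hL, dR_alg hL, X_alg, e2_alg, e3_alg, map_zero]
    rw [Algebra.commutes]
    simp
  | add b b' h1 h2 =>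
    have h : DJac K _ D a (b + b') c = DJac K _ D a b c + DJac K _ D a b' c := by
      simp only [DJac, add_tmul, tmul_add, map_add, dR_add, LinearMap.add_apply]; abel
    rw [h, h1, h2]
    simp only [map_add, e2_add, e3_add, add_mul, mul_add]
    abel
  | mul b b' h1 h2 =>
    rw [DJac_b hL, h1, h2]
    simp only [X_mul, map_add, i23_mul, i23_l, i23_r, e2_mul, e3_mul, mul_add, add_mul, mul_sub, sub_mul,
      smul_mul_assoc, mul_smul_comm, T_mul_neg, T_neg_mul, mul_assoc, c12, c13, c23, ci12, ci13, ci23,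
      c12', c13', c23', ci12', ci13', ci23']
    abel
  | grade1 j =>
    induction c using FreeAlgebra.induction with
    | grade0 r =>
      simp [DJac, D_alg_right hL, dF_alg hL]
    | grade1 k => exact hgen j k
    | add c c' h1 h2 =>
      have h : ∀ b, DJac K _ D a b (c + c') = DJac K _ D a b c + DJac K _ D a b c' := by
        intro b
        simp only [DJac, tmul_add, map_add, dF_add, LinearMap.add_apply]; abel
      rw [h, h1, h2]
      simp only [tmul_add, map_add, add_mul, mul_add, smul_add]
      abel
    | mul c c' h1 h2 =>
      rw [DJac_c hL, h1, h2, hL.1]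
      simp only [map_add, i13_mul, i13_l, i13_r, mul_add, add_mul, mul_sub, sub_mul, smul_add,
        smul_mul_assoc, mul_smul_comm, T_mul_neg, T_neg_mul, mul_assoc, c12, c13, ← c23, ci12, ci13, ci23,
        c12', c13', ← c23', ci12', ci13', ci23']
      abel

theorem freeJ {D : FreeAlgebra K ι ⊗[K] FreeAlgebra K ι →ₗ[K] FreeAlgebra K ι ⊗[K] FreeAlgebra K ι}
    (hL : LeibnizRules K (FreeAlgebra K ι) D) (hv : ι → K)
    (hS : ∀ a b, D (a ⊗ₜ b) + flipT K _ (D (b ⊗ₜ a)) =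
      X hv a * (1 ⊗ₜ b) - (b ⊗ₜ 1) * X hv a - (1 ⊗ₜ a) * flipT K _ (X hv b)
        + flipT K _ (X hv b) * (a ⊗ₜ 1))
    (hgen : ∀ i, ∀ b c, DJac K _ D (FreeAlgebra.ι K i) b c =
      - (i23 (X hv b) * i13 (D (FreeAlgebra.ι K i ⊗ₜ c)))
      + e3 K b * (hv i • i13 (D (FreeAlgebra.ι K i ⊗ₜ c)))
      - (hv i • i13 (D (FreeAlgebra.ι K i ⊗ₜ c))) * e2 K b) (a c : FreeAlgebra K ι) :
    ∃ U, ∀ b, DJac K _ D a b c =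
      - (i23 (X hv b) * i13 (D (a ⊗ₜ c))) + e3 K b * U - U * e2 K b := by
  induction a using FreeAlgebra.induction with
  | grade0 r =>
    refine ⟨0, fun b => ?_⟩
    simp [DJac, D_alg_left hL, dL_alg hL]
  | grade1 i => exact ⟨_, fun b => hgen i b c⟩
  | add a a' h1 h2 =>
    obtain ⟨U, hU⟩ := h1
    obtain ⟨V, hV⟩ := h2
    refine ⟨U + V, fun b => ?_⟩
    have h : DJac K _ D (a + a') b c = DJac K _ D a b c + DJac K _ D a' b c := by
      simp only [DJac, add_tmul, map_add, dL_add, LinearMap.add_apply]; abel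
    rw [h, hU, hV]
    simp only [add_tmul, map_add, add_mul, mul_add]
    abel
  | mul a a' h1 h2 =>
    obtain ⟨U, hU⟩ := h1
    obtain ⟨V, hV⟩ := h2
    refine ⟨e2 K a * V + U * e1 K a' + i23 (flipT K _ (X hv a)) * i13 (D (a' ⊗ₜ c)), fun b => ?_⟩
    rw [DJac_a hL, hU, hV, hS, hL.2]
    simp only [map_add, map_sub, i13_mul, i13_l, i13_r, i23_mul, i23_l, i23_r, mul_add, add_mul, mul_sub, sub_mul,
        T_mul_neg, T_neg_mul, mul_assoc, c12, c13, c23, ci12, ci13, ci23,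
        c12', c13', c23', ci12', ci13', ci23']
    abel

end free
end MDP

namespace MDP

lemma allFin3 {P : Fin 3 → Prop} (h0 : P 0) (h1 : P 1) (h2 : P 2) (i : Fin 3) : P i := by
  fin_cases i <;> assumption

@[simp] lemma otimes1_tmul {K : Type*} [Field K] {A : Type*} [Ring A] [Algebra K A] (c x y : A) :
    otimes1 K A c (x ⊗ₜ y) = (x ⊗ₜ c) ⊗ₜ y := rfl

lemma T_smul_mul {K : Type*} [Field K] {A : Type*} [Ring A] [Algebra K A] (r : K)
    (x y : (A ⊗[K] A) ⊗[K] A) : (r • x) * y = r • (x * y) := smul_mul_assoc r x y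

lemma T_mul_smul {K : Type*} [Field K] {A : Type*} [Ring A] [Algebra K A] (r : K)
    (x y : (A ⊗[K] A) ⊗[K] A) : x * (r • y) = r • (x * y) := mul_smul_comm r x y

end MDP

set_option maxHeartbeats 8000000

theorem stmt17 {K : Type*} [Field K] [IsAlgClosed K] [CharZero K]
    (a1 a2 ta3 b1 b2 tb3 : K)
    (ha1 : a1 = 0 ∨ a1 = 1)
    (ha2 : a2 = 0 ∨ a2 = 1)
    (hta3 : ta3 = 0 ∨ ta3 = 1)
    (hb1 : b1 = 0 ∨ b1 = 1)
    (hb2 : b2 = 0 ∨ b2 = 1)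
    (htb3 : tb3 = 0 ∨ tb3 = 1)
    (hacond : a1 * a2 + a2 * tb3 - a1 * tb3 - a2 = 0)
    (hbcond : b1 * b2 + b2 * ta3 - b1 * ta3 - b2 = 0)
    (D : FreeAlgebra K (Fin 3) ⊗[K] FreeAlgebra K (Fin 3) →ₗ[K] FreeAlgebra K (Fin 3) ⊗[K] FreeAlgebra K (Fin 3))
    (hL : LeibnizRules K (FreeAlgebra K (Fin 3)) D)
    (h11 : D (FreeAlgebra.ι K (0 : Fin 3) ⊗ₜ[K] FreeAlgebra.ι K (0 : Fin 3)) = 0)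
    (h22 : D (FreeAlgebra.ι K (1 : Fin 3) ⊗ₜ[K] FreeAlgebra.ι K (1 : Fin 3)) = 0)
    (h33 : D (FreeAlgebra.ι K (2 : Fin 3) ⊗ₜ[K] FreeAlgebra.ι K (2 : Fin 3)) = 0)
    (h12 : D (FreeAlgebra.ι K (0 : Fin 3) ⊗ₜ[K] FreeAlgebra.ι K (1 : Fin 3)) =
      ta3 • (FreeAlgebra.ι K (0 : Fin 3) ⊗ₜ[K] FreeAlgebra.ι K (1 : Fin 3)) - tb3 • (FreeAlgebra.ι K (1 : Fin 3) ⊗ₜ[K] FreeAlgebra.ι K (0 : Fin 3)))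
    (h21 : D (FreeAlgebra.ι K (1 : Fin 3) ⊗ₜ[K] FreeAlgebra.ι K (0 : Fin 3)) =
      (-1 + tb3) • (FreeAlgebra.ι K (0 : Fin 3) ⊗ₜ[K] FreeAlgebra.ι K (1 : Fin 3)) + (1 - ta3) • (FreeAlgebra.ι K (1 : Fin 3) ⊗ₜ[K] FreeAlgebra.ι K (0 : Fin 3)))
    (h13 : D (FreeAlgebra.ι K (0 : Fin 3) ⊗ₜ[K] FreeAlgebra.ι K (2 : Fin 3)) =
      a2 • ((1 : FreeAlgebra K (Fin 3)) ⊗ₜ[K] (FreeAlgebra.ι K (0 : Fin 3) * FreeAlgebra.ι K (2 : Fin 3))) -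
        b2 • ((FreeAlgebra.ι K (2 : Fin 3) * FreeAlgebra.ι K (0 : Fin 3)) ⊗ₜ[K] (1 : FreeAlgebra K (Fin 3))))
    (h31 : D (FreeAlgebra.ι K (2 : Fin 3) ⊗ₜ[K] FreeAlgebra.ι K (0 : Fin 3)) =
      (-1 + b2) • ((1 : FreeAlgebra K (Fin 3)) ⊗ₜ[K] (FreeAlgebra.ι K (2 : Fin 3) * FreeAlgebra.ι K (0 : Fin 3))) +
        (1 - a2) • ((FreeAlgebra.ι K (0 : Fin 3) * FreeAlgebra.ι K (2 : Fin 3)) ⊗ₜ[K] (1 : FreeAlgebra K (Fin 3))))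
    (h23 : D (FreeAlgebra.ι K (1 : Fin 3) ⊗ₜ[K] FreeAlgebra.ι K (2 : Fin 3)) =
      a1 • ((1 : FreeAlgebra K (Fin 3)) ⊗ₜ[K] (FreeAlgebra.ι K (1 : Fin 3) * FreeAlgebra.ι K (2 : Fin 3))) -
        b1 • ((FreeAlgebra.ι K (2 : Fin 3) * FreeAlgebra.ι K (1 : Fin 3)) ⊗ₜ[K] (1 : FreeAlgebra K (Fin 3))))
    (h32 : D (FreeAlgebra.ι K (2 : Fin 3) ⊗ₜ[K] FreeAlgebra.ι K (1 : Fin 3)) =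
      (-1 + b1) • ((1 : FreeAlgebra K (Fin 3)) ⊗ₜ[K] (FreeAlgebra.ι K (2 : Fin 3) * FreeAlgebra.ι K (1 : Fin 3))) +
        (1 - a1) • ((FreeAlgebra.ι K (1 : Fin 3) * FreeAlgebra.ι K (2 : Fin 3)) ⊗ₜ[K] (1 : FreeAlgebra K (Fin 3)))) :
    IsModifiedDoublePoisson K (FreeAlgebra K (Fin 3)) D := by
  have qa1 : a1 * a1 = a1 := by rcases ha1 with h | h <;> simp [h]
  have qa2 : a2 * a2 = a2 := by rcases ha2 with h | h <;> simp [h]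
  have qa3 : ta3 * ta3 = ta3 := by rcases hta3 with h | h <;> simp [h]
  have qb1 : b1 * b1 = b1 := by rcases hb1 with h | h <;> simp [h]
  have qb2 : b2 * b2 = b2 := by rcases hb2 with h | h <;> simp [h]
  have qb3 : tb3 * tb3 = tb3 := by rcases htb3 with h | h <;> simp [h]
  clear ha1 ha2 hta3 hb1 hb2 htb3
  obtain ⟨h, hh⟩ : ∃ h : K, h + h = 1 := ⟨1 / 2, by norm_num⟩
  let hv : Fin 3 → K := ![h, h, -h]
  have hv0 : hv 0 = h := rfl
  have hv1 : hv 1 = h := rfl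
  have hv2 : hv 2 = -h := rfl
  have hX0 := MDP.X_ι hv 0
  have hX1 := MDP.X_ι hv 1
  have hX2 := MDP.X_ι hv 2
  rw [hv0] at hX0
  rw [hv1] at hX1
  rw [hv2] at hX2
  have hS := MDP.freeS hL hv (by
    clear_value hv
    refine MDP.allFin3 (MDP.allFin3 ?_ ?_ ?_) (MDP.allFin3 ?_ ?_ ?_) (MDP.allFin3 ?_ ?_ ?_) <;>
    · simp only [hX0, hX1, hX2, h11, h12, h13, h21, h22, h23, h31, h32, h33, map_add, map_sub, map_smul,
        map_zero, MDP.flipT_tmul, smul_mul_assoc, mul_smul_comm, mul_add, add_mul,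
        Algebra.TensorProduct.tmul_mul_tmul, one_mul, mul_one]
      match_scalars <;> grind)
  refine MDP.criterion hL (MDP.X hv) hS (MDP.freeJ hL hv hS ?_)
  suffices hgen : ∀ i j k, DJac K _ D (FreeAlgebra.ι K i) (FreeAlgebra.ι K j) (FreeAlgebra.ι K k) =
      - (MDP.i23 (MDP.X hv (FreeAlgebra.ι K j)) * MDP.i13 (D (FreeAlgebra.ι K i ⊗ₜ FreeAlgebra.ι K k)))
      + MDP.e3 K (FreeAlgebra.ι K j) * (hv i • MDP.i13 (D (FreeAlgebra.ι K i ⊗ₜ FreeAlgebra.ι K k)))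
      - (hv i • MDP.i13 (D (FreeAlgebra.ι K i ⊗ₜ FreeAlgebra.ι K k))) * MDP.e2 K (FreeAlgebra.ι K j) from
    fun i => MDP.freeJgen hL hv (hv i) (FreeAlgebra.ι K i) (hgen i)
  clear_value hv
  have hor := MDP.D_one_right hL
  have hol := MDP.D_one_left hL
  refine MDP.allFin3
    (MDP.allFin3 (MDP.allFin3 ?_ ?_ ?_) (MDP.allFin3 ?_ ?_ ?_) (MDP.allFin3 ?_ ?_ ?_))
    (MDP.allFin3 (MDP.allFin3 ?_ ?_ ?_) (MDP.allFin3 ?_ ?_ ?_) (MDP.allFin3 ?_ ?_ ?_))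
    (MDP.allFin3 (MDP.allFin3 ?_ ?_ ?_) (MDP.allFin3 ?_ ?_ ?_) (MDP.allFin3 ?_ ?_ ?_)) <;>
  · simp only [DJac, hX0, hX1, hX2, hv0, hv1, hv2, h11, h12, h13, h21, h22, h23, h31, h32, h33,
      hL.1, hL.2, hor, hol, map_add, map_sub, map_smul, map_zero, MDP.dL_tmul, MDP.dR_tmul,
      MDP.dLfst_tmul, MDP.otimes1_tmul, MDP.i23_tmul, MDP.i13_tmul, MDP.e2, MDP.e3,
      MDP.T_smul_mul, MDP.T_mul_smul,
      smul_mul_assoc, mul_smul_comm, mul_add, add_mul, mul_sub, sub_mul, tmul_add, add_tmul,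
      tmul_sub, sub_tmul, tmul_smul, ← smul_tmul', mul_zero, zero_mul, tmul_zero, zero_tmul, smul_zero,
      TensorProduct.assoc_symm_tmul,
      Algebra.TensorProduct.tmul_mul_tmul, one_mul, mul_one, mul_assoc]
    first
      | done
      | (clear hor hol hS hX0 hX1 hX2 h11 h12 h13 h21 h22 h23 h31 h32 h33 hL hv0 hv1 hv2
         match_scalars <;> grind)
end
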